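/- Let Σ be an open convex cone in ℝⁿ (n ≥ 1). Then for every bounded Lipschitz domain Ω ⊂ Σ, the relative perimeter and Lebesgue volume satisfy P_Σ(Ω) / |Ω|^{(n-1)/n} ≥ P_Σ(Σ ∩ B₁) / |Σ ∩ B₁|^{(n-1)/n}, where P_Σ(Ω) = σ(Σ ∩ ∂Ω) is the (n−1)-dimensional surface measure of the part of ∂Ω lying inside Σ, |·| denotes Lebesgue measure, and B₁ is the open Euclidean unit ball centered at the origin. (This is the isoperimetric inequality in convex cones of Lions and Pacella, the case w ≡ 1 of the main theorem.) -/

import Mathlib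

open MeasureTheory Metric Set
open scoped RealInnerProductSpace NNReal ENNReal

noncomputable section

/-- A bounded Lipschitz domain in `ℝⁿ`: a bounded, connected, open set whose boundary is
locally the graph of a Lipschitz function (the set lying locally on one side of the graph). -/
def IsLipschitzDomain {n : ℕ} (Ω : Set (EuclideanSpace ℝ (Fin n))) : Prop :=
  IsOpen Ω ∧ IsConnected Ω ∧ Bornology.IsBounded Ω ∧
  ∀ x ∈ frontier Ω, ∃ r > (0:ℝ), ∃ v : EuclideanSpace ℝ (Fin n), ‖v‖ = 1 ∧
    ∃ (K : ℝ≥0) (φ : EuclideanSpace ℝ (Fin n) → ℝ), LipschitzWith K φ ∧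
      ∀ y ∈ ball x r, (y ∈ Ω ↔ φ (y - ⟪y, v⟫ • v) < ⟪y, v⟫)

open Filter Topology Pointwise

theorem IsCompact.volume_add_volume_le_volume_add {A B : Set ℝ} (hA : IsCompact A)
    (hB : IsCompact B) (hA' : A.Nonempty) (hB' : B.Nonempty) :
    volume A + volume B ≤ volume (A + B) := by
  have ha := hA.sSup_mem hA'
  have hb := hB.sInf_mem hB'
  set a := sSup A
  set b := sInf B
  have h1 : volume ((fun x => x + b) '' A) = volume A := by
    simp [image_add_right]
  have h2 : volume ((fun x => a + x) '' B) = volume B := by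
    simp [image_add_left]
  have hdis : AEDisjoint volume ((fun x => x + b) '' A) ((fun x => a + x) '' B) := by
    refine measure_mono_null (t := {a + b}) ?_ (by simp)
    rintro _ ⟨⟨x, hx, rfl⟩, ⟨y, hy, hxy⟩⟩
    have h3 : x ≤ a := le_csSup hA.bddAbove hx
    have h4 : b ≤ y := csInf_le hB.bddBelow hy
    simp only at hxy ⊢
    rw [mem_singleton_iff]
    linarith
  rw [← h1, ← h2, ← measure_union₀
    ((hB.image (by fun_prop : Continuous fun x => a + x)).measurableSet.nullMeasurableSet) hdis]
  apply measure_mono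
  rintro _ (⟨x, hx, rfl⟩ | ⟨x, hx, rfl⟩)
  · exact add_mem_add hx hb
  · exact add_mem_add ha hx

theorem exists_isCompact_nonempty_le_volume {A : Set ℝ} (hA : MeasurableSet A)
    (hA' : A.Nonempty) {r : ℝ≥0∞} (hr : r < volume A ∨ r = 0) :
    ∃ K ⊆ A, IsCompact K ∧ K.Nonempty ∧ r ≤ volume K := by
  rcases hr with hr | rfl
  · obtain ⟨K, hKA, hK, hrK⟩ := hA.exists_lt_isCompact hr
    exact ⟨K, hKA, hK, nonempty_of_measure_ne_zero (zero_le.trans_lt hrK).ne', hrK.le⟩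
  · obtain ⟨x, hx⟩ := hA'
    exact ⟨{x}, by simpa using hx, isCompact_singleton, by simp, by simp⟩

theorem volume_add_volume_le_of_add_subset {A B C : Set ℝ} (hA : MeasurableSet A)
    (hB : MeasurableSet B) (hA' : A.Nonempty) (hB' : B.Nonempty) (hC : A + B ⊆ C) :
    volume A + volume B ≤ volume C := by
  have key : ∀ r s : ℝ≥0∞, (r < volume A ∨ r = 0) → (s < volume B ∨ s = 0) →
      r + s ≤ volume C := by
    intro r s hr hs
    obtain ⟨K, h1, h2, h3, h4⟩ := exists_isCompact_nonempty_le_volume hA hA' hr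
    obtain ⟨L, k1, k2, k3, k4⟩ := exists_isCompact_nonempty_le_volume hB hB' hs
    calc r + s ≤ volume K + volume L := add_le_add h4 k4
      _ ≤ volume (K + L) := h2.volume_add_volume_le_volume_add k2 h3 k3
      _ ≤ volume C := measure_mono ((add_subset_add h1 k1).trans hC)
  have key2 : ∀ s : ℝ≥0∞, (s < volume B ∨ s = 0) → volume A + s ≤ volume C := by
    intro s hs
    rcases eq_or_ne (volume A) 0 with h0 | h0
    · rw [h0]
      exact key 0 s (Or.inr rfl) hs
    · have : (𝓝[<] volume A).NeBot := nhdsLT_neBot_of_exists_lt ⟨0, h0.bot_lt⟩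
      have : Tendsto (fun r => r + s) (𝓝[<] volume A) (𝓝 (volume A + s)) :=
        (by fun_prop : Continuous fun r : ℝ≥0∞ => r + s).continuousAt.mono_left nhdsWithin_le_nhds
      exact le_of_tendsto this (eventually_mem_nhdsWithin.mono fun r hr => key r s (Or.inl hr) hs)
  rcases eq_or_ne (volume B) 0 with h0 | h0
  · rw [h0]
    exact key2 0 (Or.inr rfl)
  · have : (𝓝[<] volume B).NeBot := nhdsLT_neBot_of_exists_lt ⟨0, h0.bot_lt⟩
    have : Tendsto (fun r => volume A + r) (𝓝[<] volume B) (𝓝 (volume A + volume B)) :=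
      (by fun_prop : Continuous fun r : ℝ≥0∞ => volume A + r).continuousAt.mono_left nhdsWithin_le_nhds
    exact le_of_tendsto this (eventually_mem_nhdsWithin.mono fun r hr => key2 r (Or.inl hr))


theorem ENNReal.rpow_mul_rpow_le_add {a b : ℝ} (ha : 0 < a) (hb : 0 < b) (hab : a + b = 1)
    (x y : ℝ≥0∞) : x ^ a * y ^ b ≤ ENNReal.ofReal a * x + ENNReal.ofReal b * y := by
  rcases eq_or_ne x ∞ with rfl | hx
  · simp [ENNReal.mul_top, ha]
  rcases eq_or_ne y ∞ with rfl | hy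
  · simp [ENNReal.mul_top, hb]
  lift x to ℝ≥0 using hx
  lift y to ℝ≥0 using hy
  lift a to ℝ≥0 using ha.le
  lift b to ℝ≥0 using hb.le
  have := NNReal.geom_mean_le_arith_mean2_weighted a b x y (by exact_mod_cast hab)
  rw [← ENNReal.coe_rpow_of_nonneg _ ha.le, ← ENNReal.coe_rpow_of_nonneg _ hb.le]
  simpa using (by exact_mod_cast this : ((x ^ (a : ℝ) * y ^ (b : ℝ) : ℝ≥0) : ℝ≥0∞) ≤ a * x + b * y)

theorem lintegral_eq_lintegral_Ioo_of_le_one {f : ℝ → ℝ≥0∞} (hf : Measurable f)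
    (hf1 : ∀ x, f x ≤ 1) :
    ∫⁻ x, f x = ∫⁻ t in Ioo (0 : ℝ) 1, volume {x | ENNReal.ofReal t < f x} := by
  have hfin : ∀ x, f x ≠ ∞ := fun x => ((hf1 x).trans_lt ENNReal.one_lt_top).ne
  have h1 : ∫⁻ x, f x = ∫⁻ x, ENNReal.ofReal (f x).toReal := by
    simp [ENNReal.ofReal_toReal, hfin]
  rw [h1, lintegral_eq_lintegral_meas_lt volume (ae_of_all _ fun x => ENNReal.toReal_nonneg)
    hf.ennreal_toReal.aemeasurable]
  have h2 : ∀ t ∈ Ioi (0 : ℝ), volume {x | t < (f x).toReal} =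
      (Ioo (0 : ℝ) 1).indicator (fun t => volume {x | ENNReal.ofReal t < f x}) t := by
    intro t ht
    by_cases ht1 : t < 1
    · rw [indicator_of_mem (show t ∈ Ioo (0 : ℝ) 1 from ⟨ht, ht1⟩)]
      congr 1
      ext x
      exact (ENNReal.ofReal_lt_iff_lt_toReal (mem_Ioi.1 ht).le (hfin x)).symm
    · rw [indicator_of_notMem (fun h => ht1 h.2)]
      have : {x | t < (f x).toReal} = ∅ := by
        ext x
        simp only [mem_ofPred_eq, mem_empty_iff_false, iff_false, not_lt]
        exact (ENNReal.toReal_le_of_le_ofReal zero_le_one (by simpa using hf1 x)).trans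
          (not_lt.1 ht1)
      rw [this, measure_empty]
  rw [setLIntegral_congr_fun measurableSet_Ioi h2, setLIntegral_indicator measurableSet_Ioo]
  congr 2
  ext t
  simp +contextual

/-- Weighted one-dimensional Prékopa–Leindler inequality for functions normalised to have
supremum one; the left side is the arithmetic mean. -/
theorem prekopaLeindler_real_normalized {a b : ℝ} (ha : 0 < a) (hb : 0 < b) (hab : a + b = 1)
    {f g h : ℝ → ℝ≥0∞} (hf : Measurable f) (hg : Measurable g) (hh : Measurable h)
    (hf1 : ⨆ x, f x = 1) (hg1 : ⨆ x, g x = 1)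
    (hfgh : ∀ x y, f x ^ a * g y ^ b ≤ h (a • x + b • y)) :
    (∫⁻ x, f x) ^ a * (∫⁻ x, g x) ^ b ≤ ∫⁻ x, h x := by
  refine (ENNReal.rpow_mul_rpow_le_add ha hb hab _ _).trans ?_
  have hmin : Measurable fun x => min (h x) 1 := hh.min measurable_const
  refine le_trans ?_ (lintegral_mono fun x => min_le_left (h x) 1)
  rw [lintegral_eq_lintegral_Ioo_of_le_one hf (fun x => hf1 ▸ le_iSup f x),
    lintegral_eq_lintegral_Ioo_of_le_one hg (fun x => hg1 ▸ le_iSup g x),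
    lintegral_eq_lintegral_Ioo_of_le_one hmin (fun x => min_le_right _ _),
    ← lintegral_const_mul' _ _ ENNReal.ofReal_ne_top,
    ← lintegral_const_mul' _ _ ENNReal.ofReal_ne_top]
  have hanti : Antitone fun t : ℝ => volume {x | ENNReal.ofReal t < f x} := fun s t hst =>
    measure_mono fun x hx => (ENNReal.ofReal_le_ofReal hst).trans_lt hx
  rw [← lintegral_add_left (hanti.measurable.const_mul _)]
  refine setLIntegral_mono' measurableSet_Ioo fun t ht => ?_
  have ht1 : ENNReal.ofReal t < 1 := by simpa using ht.2
  obtain ⟨x₀, hx₀⟩ := lt_iSup_iff.1 (hf1 ▸ ht1)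
  obtain ⟨y₀, hy₀⟩ := lt_iSup_iff.1 (hg1 ▸ ht1)
  have hsub : a • {x | ENNReal.ofReal t < f x} + b • {x | ENNReal.ofReal t < g x} ⊆
      {x | ENNReal.ofReal t < min (h x) 1} := by
    rintro _ ⟨_, ⟨x, hx, rfl⟩, _, ⟨y, hy, rfl⟩, rfl⟩
    refine lt_min (lt_of_lt_of_le ?_ (hfgh x y)) ht1
    calc ENNReal.ofReal t = ENNReal.ofReal t ^ a * ENNReal.ofReal t ^ b := by
          rw [← ENNReal.rpow_add_of_nonneg _ _ ha.le hb.le, hab, ENNReal.rpow_one]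
      _ < f x ^ a * g y ^ b := ENNReal.mul_lt_mul (ENNReal.rpow_lt_rpow hx ha)
          (ENNReal.rpow_lt_rpow hy hb)
  have := volume_add_volume_le_of_add_subset
    ((measurableSet_lt measurable_const hf).const_smul_of_ne_zero ha.ne')
    ((measurableSet_lt measurable_const hg).const_smul_of_ne_zero hb.ne')
    (Nonempty.smul_set ⟨x₀, hx₀⟩) (Nonempty.smul_set ⟨y₀, hy₀⟩) hsub
  simpa [Measure.addHaar_smul, abs_of_pos ha, abs_of_pos hb] using this

theorem prekopaLeindler_real_bounded {a b : ℝ} (ha : 0 < a) (hb : 0 < b) (hab : a + b = 1)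
    {f g h : ℝ → ℝ≥0∞} (hf : Measurable f) (hg : Measurable g) (hh : Measurable h)
    (hf1 : ⨆ x, f x ≠ ∞) (hg1 : ⨆ x, g x ≠ ∞)
    (hfgh : ∀ x y, f x ^ a * g y ^ b ≤ h (a • x + b • y)) :
    (∫⁻ x, f x) ^ a * (∫⁻ x, g x) ^ b ≤ ∫⁻ x, h x := by
  set M := ⨆ x, f x with hM
  set N := ⨆ x, g x with hN
  rcases eq_or_ne M 0 with hM0 | hM0
  · have : ∀ x, f x = 0 := by simpa [hM] using hM0
    simp [this, ha]
  rcases eq_or_ne N 0 with hN0 | hN0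
  · have : ∀ x, g x = 0 := by simpa [hN] using hN0
    simp [this, hb]
  have hMa : M ^ a ≠ 0 := by simp [ENNReal.rpow_eq_zero_iff, hM0, ha.not_gt]
  have hNb : N ^ b ≠ 0 := by simp [ENNReal.rpow_eq_zero_iff, hN0, hb.not_gt]
  have hMa' : M ^ a ≠ ∞ := ENNReal.rpow_ne_top_of_nonneg ha.le hf1
  have hNb' : N ^ b ≠ ∞ := ENNReal.rpow_ne_top_of_nonneg hb.le hg1
  have key := prekopaLeindler_real_normalized ha hb hab (f := fun x => M⁻¹ * f x)
    (g := fun x => N⁻¹ * g x) (h := fun x => (M ^ a * N ^ b)⁻¹ * h x)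
    (hf.const_mul _) (hg.const_mul _) (hh.const_mul _)
    (by rw [← ENNReal.mul_iSup]; exact ENNReal.inv_mul_cancel hM0 hf1)
    (by rw [← ENNReal.mul_iSup]; exact ENNReal.inv_mul_cancel hN0 hg1)
    (fun x y => by
      rw [ENNReal.mul_rpow_of_nonneg _ _ ha.le, ENNReal.mul_rpow_of_nonneg _ _ hb.le,
        ENNReal.inv_rpow, ENNReal.inv_rpow, mul_mul_mul_comm,
        ← ENNReal.mul_inv (Or.inl hMa) (Or.inl hMa')]
      gcongr
      exact hfgh x y)
  rw [lintegral_const_mul' _ _ (by simpa using hM0), lintegral_const_mul' _ _ (by simpa using hN0),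
    lintegral_const_mul' _ _ (by simp [hMa, hNb]),
    ENNReal.mul_rpow_of_nonneg _ _ ha.le, ENNReal.mul_rpow_of_nonneg _ _ hb.le,
    ENNReal.inv_rpow, ENNReal.inv_rpow, mul_mul_mul_comm,
    ← ENNReal.mul_inv (Or.inl hMa) (Or.inl hMa')] at key
  exact (ENNReal.mul_le_mul_iff_right (ENNReal.inv_ne_zero.2 (ENNReal.mul_ne_top hMa' hNb'))
    (ENNReal.inv_ne_top.2 (mul_ne_zero hMa hNb))).1 key

/-- The Prékopa–Leindler inequality, as a property of a measured real vector space. -/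
def PrekopaLeindler (X : Type*) [MeasureSpace X] [AddCommGroup X] [Module ℝ X] : Prop :=
  ∀ ⦃a b : ℝ⦄, 0 < a → 0 < b → a + b = 1 → ∀ ⦃f g h : X → ℝ≥0∞⦄,
    Measurable f → Measurable g → Measurable h →
    (∀ x y, f x ^ a * g y ^ b ≤ h (a • x + b • y)) →
    (∫⁻ x, f x) ^ a * (∫⁻ x, g x) ^ b ≤ ∫⁻ x, h x

theorem ENNReal.iSup_min_natCast (x : ℝ≥0∞) : ⨆ n : ℕ, min x n = x := by
  rw [← inf_iSup_eq]
  simp [ENNReal.iSup_natCast]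

theorem tendsto_lintegral_min_natCast {X : Type*} [MeasureSpace X] {f : X → ℝ≥0∞}
    (hf : Measurable f) :
    Tendsto (fun n : ℕ => ∫⁻ x, min (f x) n) atTop (𝓝 (∫⁻ x, f x)) := by
  have hmono : Monotone fun (n : ℕ) x => min (f x) (n : ℝ≥0∞) := fun m n hmn x =>
    min_le_min_left _ (by exact_mod_cast hmn)
  have := lintegral_iSup (μ := (volume : Measure X)) (fun n : ℕ => hf.min (measurable_const (a := (n : ℝ≥0∞)))) hmono
  simp only [ENNReal.iSup_min_natCast] at this
  rw [this]
  exact tendsto_atTop_iSup fun m n hmn => lintegral_mono (hmono hmn)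

theorem prekopaLeindler_real : PrekopaLeindler ℝ := by
  intro a b ha hb hab f g h hf hg hh hfgh
  rcases eq_or_ne (∫⁻ x, f x) 0 with hf0 | hf0
  · simp [hf0, ha]
  rcases eq_or_ne (∫⁻ x, g x) 0 with hg0 | hg0
  · simp [hg0, hb]
  have hlim := ENNReal.Tendsto.mul
    ((ENNReal.continuous_rpow_const (y := a)).tendsto _ |>.comp (tendsto_lintegral_min_natCast hf))
    (Or.inl (by simp [ENNReal.rpow_eq_zero_iff, hf0, ha.not_gt]))
    ((ENNReal.continuous_rpow_const (y := b)).tendsto _ |>.comp (tendsto_lintegral_min_natCast hg))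
    (Or.inl (by simp [ENNReal.rpow_eq_zero_iff, hg0, hb.not_gt]))
  refine le_of_tendsto' hlim fun n => ?_
  have hbdd : ∀ u : ℝ → ℝ≥0∞, ⨆ x, min (u x) (n : ℝ≥0∞) ≠ ∞ := fun u =>
    ((iSup_le fun x => min_le_right _ _).trans_lt (ENNReal.natCast_lt_top n)).ne
  refine prekopaLeindler_real_bounded ha hb hab (hf.min measurable_const)
    (hg.min measurable_const) hh (hbdd f) (hbdd g) fun x y => le_trans ?_ (hfgh x y)
  gcongr <;> exact min_le_left _ _

theorem PrekopaLeindler.prod {X Y : Type*} [MeasureSpace X] [AddCommGroup X] [Module ℝ X]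
    [MeasureSpace Y] [AddCommGroup Y] [Module ℝ Y] [SFinite (volume : Measure Y)]
    (hX : PrekopaLeindler X) (hY : PrekopaLeindler Y) : PrekopaLeindler (X × Y) := by
  intro a b ha hb hab f g h hf hg hh hfgh
  simp only [Measure.volume_eq_prod]
  rw [lintegral_prod _ hf.aemeasurable, lintegral_prod _ hg.aemeasurable,
    lintegral_prod _ hh.aemeasurable]
  refine hX ha hb hab hf.lintegral_prod_right' hg.lintegral_prod_right' hh.lintegral_prod_right'
    fun x₁ x₂ => ?_
  exact hY ha hb hab (hf.comp measurable_prodMk_left) (hg.comp measurable_prodMk_left)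
    (hh.comp measurable_prodMk_left) fun y₁ y₂ => hfgh (x₁, y₁) (x₂, y₂)

theorem PrekopaLeindler.of_measurePreserving {X Y : Type*} [MeasureSpace X] [AddCommGroup X]
    [Module ℝ X] [MeasureSpace Y] [AddCommGroup Y] [Module ℝ Y] (hX : PrekopaLeindler X)
    (e : X →ₗ[ℝ] Y) (he : MeasurePreserving e) : PrekopaLeindler Y := by
  intro a b ha hb hab f g h hf hg hh hfgh
  rw [← he.lintegral_comp hf, ← he.lintegral_comp hg, ← he.lintegral_comp hh]
  refine hX ha hb hab (hf.comp he.measurable) (hg.comp he.measurable) (hh.comp he.measurable)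
    fun x y => ?_
  simpa using hfgh (e x) (e y)

theorem prekopaLeindler_pi (n : ℕ) : PrekopaLeindler (Fin n → ℝ) := by
  induction n with
  | zero =>
    intro a b ha hb hab f g h hf hg hh hfgh
    simp only [lintegral_unique, Measure.volume_pi_eq_dirac (0 : Fin 0 → ℝ), measure_univ, mul_one]
    convert hfgh default default
  | succ n ih =>
    refine (prekopaLeindler_real.prod ih).of_measurePreserving
      (Fin.consLinearEquiv ℝ fun _ : Fin (n + 1) => ℝ).toLinearMap ?_
    have heq : ⇑(Fin.consLinearEquiv ℝ fun _ : Fin (n + 1) => ℝ).toLinearMap =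
        (MeasurableEquiv.piFinSuccAbove (fun _ : Fin (n + 1) => ℝ) 0).symm := by
      funext p
      simp [MeasurableEquiv.piFinSuccAbove, Fin.consLinearEquiv]
    rw [heq]
    exact (volume_preserving_piFinSuccAbove (fun _ : Fin (n + 1) => ℝ) 0).symm

theorem prekopaLeindler_euclideanSpace (n : ℕ) : PrekopaLeindler (EuclideanSpace ℝ (Fin n)) :=
  (prekopaLeindler_pi n).of_measurePreserving
    ((WithLp.linearEquiv 2 ℝ (Fin n → ℝ)).symm : (Fin n → ℝ) →ₗ[ℝ] EuclideanSpace ℝ (Fin n))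
    (PiLp.volume_preserving_toLp (Fin n))

/-- Multiplicative form of the Brunn–Minkowski inequality. -/
theorem volume_rpow_mul_volume_rpow_le {n : ℕ} {a b : ℝ} (ha : 0 < a) (hb : 0 < b)
    (hab : a + b = 1) {A B : Set (EuclideanSpace ℝ (Fin n))} (hA : MeasurableSet A)
    (hB : MeasurableSet B) (hC : MeasurableSet (a • A + b • B)) :
    volume A ^ a * volume B ^ b ≤ volume (a • A + b • B) := by
  have := prekopaLeindler_euclideanSpace n ha hb hab (f := A.indicator 1) (g := B.indicator 1)
    (h := (a • A + b • B).indicator 1) (measurable_one.indicator hA) (measurable_one.indicator hB)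
    (measurable_one.indicator hC) fun x y => by
      by_cases hx : x ∈ A
      · by_cases hy : y ∈ B
        · simp [hx, hy, add_mem_add (smul_mem_smul_set (a := a) hx) (smul_mem_smul_set (a := b) hy)]
        · simp [hy, hb]
      · simp [hx, ha]
  simpa [lintegral_indicator_one hA, lintegral_indicator_one hB, lintegral_indicator_one hC]
    using this

/-- **Brunn–Minkowski inequality** for an open set and a measurable set. -/
theorem brunnMinkowski {n : ℕ} {A B : Set (EuclideanSpace ℝ (Fin n))}
    (hA : IsOpen A) (hB : MeasurableSet B) {r s : ℝ} (hr : 0 < r) (hs : 0 < s)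
    (hAr : volume A = ENNReal.ofReal (r ^ n)) (hBs : volume B = ENNReal.ofReal (s ^ n)) :
    ENNReal.ofReal ((r + s) ^ n) ≤ volume (A + B) := by
  have hrs : 0 < r + s := add_pos hr hs
  set a := r / (r + s) with ha
  set b := s / (r + s) with hb
  have ha0 : 0 < a := div_pos hr hrs
  have hb0 : 0 < b := div_pos hs hrs
  have hab : a + b = 1 := by rw [ha, hb]; field_simp
  have h1 : a • (a⁻¹ • A) = A := smul_inv_smul₀ ha0.ne' A
  have h2 : b • (b⁻¹ • B) = B := smul_inv_smul₀ hb0.ne' B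
  have key := volume_rpow_mul_volume_rpow_le ha0 hb0 hab
    (A := a⁻¹ • A) (B := b⁻¹ • B) (hA.measurableSet.const_smul_of_ne_zero (inv_ne_zero ha0.ne'))
    (hB.const_smul_of_ne_zero (inv_ne_zero hb0.ne')) (by
      rw [h1, h2]; exact (hA.add_right).measurableSet)
  rw [h1, h2] at key
  refine le_trans (le_of_eq ?_) key
  have h3 : volume (a⁻¹ • A) = ENNReal.ofReal ((r + s) ^ n) := by
    rw [Measure.addHaar_smul, hAr, finrank_euclideanSpace_fin, abs_of_pos (by positivity),
      ← ENNReal.ofReal_mul (by positivity), ← mul_pow, ha]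
    congr 2
    field_simp
  have h4 : volume (b⁻¹ • B) = ENNReal.ofReal ((r + s) ^ n) := by
    rw [Measure.addHaar_smul, hBs, finrank_euclideanSpace_fin, abs_of_pos (by positivity),
      ← ENNReal.ofReal_mul (by positivity), ← mul_pow, hb]
    congr 2
    field_simp
  rw [h3, h4, ← ENNReal.rpow_add_of_nonneg _ _ ha0.le hb0.le, hab, ENNReal.rpow_one]

/-- Orthonormal coordinates of `ℝ^(m+1)` adapted to a unit vector `v`: an isometric embedding of
`ℝ^m` onto the hyperplane orthogonal to `v`. -/
structure IsFrame {m : ℕ} (ι : EuclideanSpace ℝ (Fin m) →ₗᵢ[ℝ] EuclideanSpace ℝ (Fin (m + 1)))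
    (v : EuclideanSpace ℝ (Fin (m + 1))) : Prop where
  norm_eq_one : ‖v‖ = 1
  inner_eq_zero : ∀ x, ⟪ι x, v⟫ = 0

theorem exists_isFrame {m : ℕ} {v : EuclideanSpace ℝ (Fin (m + 1))} (hv : ‖v‖ = 1) :
    ∃ ι : EuclideanSpace ℝ (Fin m) →ₗᵢ[ℝ] EuclideanSpace ℝ (Fin (m + 1)), IsFrame ι v := by
  have hfin : Fact (Module.finrank ℝ (EuclideanSpace ℝ (Fin (m + 1))) = m + 1) := ⟨by simp⟩
  have hv0 : v ≠ 0 := fun h => by simp [h] at hv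
  refine ⟨(ℝ ∙ v)ᗮ.subtypeₗᵢ.comp
    (OrthonormalBasis.fromOrthogonalSpanSingleton m hv0).repr.symm.toLinearIsometry, hv, fun x => ?_⟩
  exact (Submodule.mem_orthogonal_singleton_iff_inner_left.1 (Subtype.prop _))

namespace IsFrame

variable {m : ℕ} {ι : EuclideanSpace ℝ (Fin m) →ₗᵢ[ℝ] EuclideanSpace ℝ (Fin (m + 1))}
  {v : EuclideanSpace ℝ (Fin (m + 1))}

theorem inner_add_smul (h : IsFrame ι v) (x : EuclideanSpace ℝ (Fin m)) (t : ℝ) :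
    ⟪ι x + t • v, v⟫ = t := by
  rw [inner_add_left, h.inner_eq_zero, real_inner_smul_left, real_inner_self_eq_norm_sq,
    h.norm_eq_one]
  ring

theorem norm_add_smul_sq (h : IsFrame ι v) (x : EuclideanSpace ℝ (Fin m)) (t : ℝ) :
    ‖ι x + t • v‖ ^ 2 = ‖x‖ ^ 2 + t ^ 2 := by
  rw [norm_add_sq_real, real_inner_smul_right, h.inner_eq_zero, norm_smul, h.norm_eq_one,
    ι.norm_map, mul_one, Real.norm_eq_abs, sq_abs]
  ring

theorem norm_le_norm_add_smul (h : IsFrame ι v) (x : EuclideanSpace ℝ (Fin m)) (t : ℝ) :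
    ‖x‖ ≤ ‖ι x + t • v‖ := by
  have := h.norm_add_smul_sq x t
  nlinarith [norm_nonneg x, norm_nonneg (ι x + t • v), sq_nonneg t]

theorem exists_linearIsometryEquiv (h : IsFrame ι v) :
    ∃ e : WithLp 2 (EuclideanSpace ℝ (Fin m) × ℝ) ≃ₗᵢ[ℝ] EuclideanSpace ℝ (Fin (m + 1)),
      ∀ p, e p = ι p.fst + p.snd • v := by
  let f : WithLp 2 (EuclideanSpace ℝ (Fin m) × ℝ) →ₗ[ℝ] EuclideanSpace ℝ (Fin (m + 1)) :=
    (ι.toLinearMap.coprod (LinearMap.toSpanSingleton ℝ _ v)) ∘ₗ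
      (WithLp.linearEquiv 2 ℝ (EuclideanSpace ℝ (Fin m) × ℝ)).toLinearMap
  have hf : ∀ p, f p = ι p.fst + p.snd • v := fun p => rfl
  refine ⟨LinearIsometry.toLinearIsometryEquiv ⟨f, fun p => ?_⟩ ?_, fun p => ?_⟩
  · rw [← sq_eq_sq₀ (norm_nonneg _) (norm_nonneg _), hf, h.norm_add_smul_sq,
      WithLp.prod_norm_sq_eq_of_L2]
    simp
  · have : Module.finrank ℝ (WithLp 2 (EuclideanSpace ℝ (Fin m) × ℝ)) =
        Module.finrank ℝ (EuclideanSpace ℝ (Fin m) × ℝ) :=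
      (WithLp.linearEquiv 2 ℝ (EuclideanSpace ℝ (Fin m) × ℝ)).finrank_eq
    rw [this]
    simp
  · simp [hf]

theorem measurePreserving (h : IsFrame ι v) :
    MeasurePreserving fun p : EuclideanSpace ℝ (Fin m) × ℝ => ι p.1 + p.2 • v := by
  obtain ⟨e, he⟩ := h.exists_linearIsometryEquiv
  have := e.measurePreserving.comp (WithLp.volume_preserving_toLp (EuclideanSpace ℝ (Fin m)) ℝ)
  convert this using 2
  simp [he]

theorem exists_eq (h : IsFrame ι v) (y : EuclideanSpace ℝ (Fin (m + 1))) :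
    ∃ x, y = ι x + ⟪y, v⟫ • v := by
  obtain ⟨e, he⟩ := h.exists_linearIsometryEquiv
  obtain ⟨p, rfl⟩ := e.surjective y
  refine ⟨p.fst, ?_⟩
  rw [he, h.inner_add_smul]

theorem volume_eq_lintegral (h : IsFrame ι v) {s : Set (EuclideanSpace ℝ (Fin (m + 1)))}
    (hs : MeasurableSet s) :
    volume s = ∫⁻ x, volume {t : ℝ | ι x + t • v ∈ s} := by
  rw [← h.measurePreserving.measure_preimage hs.nullMeasurableSet, Measure.volume_eq_prod,
    Measure.prod_apply (h.measurePreserving.measurable hs)]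
  rfl

end IsFrame

theorem LipschitzOnWith.euclideanHausdorffMeasure_image_le {X Y : Type*} [EMetricSpace X]
    [MeasurableSpace X] [BorelSpace X] [EMetricSpace Y] [MeasurableSpace Y] [BorelSpace Y]
    {K : ℝ≥0} {f : X → Y} {s : Set X} (h : LipschitzOnWith K f s) (d : ℕ) :
    μHE[d] (f '' s) ≤ (K : ℝ≥0∞) ^ d * μHE[d] s := by
  have := h.hausdorffMeasure_image_le (d := d) (by positivity)
  simp only [Measure.euclideanHausdorffMeasure_def, Measure.smul_apply, ENNReal.smul_def,
    smul_eq_mul]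
  rw [mul_left_comm]
  gcongr
  simpa using this

/-- The area of the image of a set under the graph map of a linear form with gradient `a`. -/
theorem euclideanHausdorffMeasure_image_linearMap {m : ℕ} {E : Type*} [NormedAddCommGroup E]
    [NormedSpace ℝ E] [MeasurableSpace E] [BorelSpace E] (a : EuclideanSpace ℝ (Fin m))
    (L : EuclideanSpace ℝ (Fin m) →ₗ[ℝ] E) (hL : ∀ x, ‖L x‖ ^ 2 = ‖x‖ ^ 2 + ⟪a, x⟫ ^ 2)
    (W : Set (EuclideanSpace ℝ (Fin m))) :
    μHE[m] (L '' W) = ENNReal.ofReal (√(1 + ‖a‖ ^ 2)) * volume W := by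
  set J := √(1 + ‖a‖ ^ 2) with hJ
  have hJ2 : J ^ 2 = 1 + ‖a‖ ^ 2 := Real.sq_sqrt (by positivity)
  have hJ0 : 0 < J := Real.sqrt_pos.2 (by positivity)
  set κ := (J + 1)⁻¹ with hκ
  have hκJ : κ * (J + 1) = 1 := inv_mul_cancel₀ (by positivity)
  let M : EuclideanSpace ℝ (Fin m) →ₗ[ℝ] EuclideanSpace ℝ (Fin m) :=
    LinearMap.transvection (innerₛₗ ℝ a) (κ • a)
  have hM : ∀ x, M x = x + ⟪a, x⟫ • κ • a := fun x => rfl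
  have hdet : LinearMap.det M = J := by
    rw [LinearMap.transvection.det]
    simp only [innerₛₗ_apply_apply, real_inner_smul_right, real_inner_self_eq_norm_sq]
    have : ‖a‖ ^ 2 = (J - 1) * (J + 1) := by linarith
    rw [this]
    linear_combination (J - 1) * hκJ
  let e := LinearMap.equivOfDetNeZero M (by rw [hdet]; exact hJ0.ne')
  have he : ∀ x, e x = M x := fun x => rfl
  have hnorm : ∀ x, ‖M x‖ = ‖L x‖ := by
    intro x
    rw [← sq_eq_sq₀ (norm_nonneg _) (norm_nonneg _), hL, hM, norm_add_sq_real]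
    simp only [real_inner_smul_right, norm_smul, Real.norm_eq_abs, mul_pow, sq_abs]
    rw [real_inner_comm a x]
    have : ‖a‖ ^ 2 = (J - 1) * (J + 1) := by linarith
    rw [this]
    linear_combination (⟪a, x⟫ ^ 2 * (κ * (J - 1) + 1)) * hκJ
  have hiso : Isometry (L ∘ₗ e.symm.toLinearMap) := by
    refine AddMonoidHomClass.isometry_of_norm _ fun y => ?_
    obtain ⟨x, rfl⟩ := e.surjective y
    rw [LinearMap.comp_apply, LinearEquiv.coe_coe, e.symm_apply_apply, he, hnorm]
  have himg : L '' W = (L ∘ₗ e.symm.toLinearMap) '' (M '' W) := by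
    rw [image_image]
    refine image_congr fun x _ => ?_
    rw [← he]
    simp
  rw [himg, hiso.euclideanHausdorffMeasure_image, EuclideanSpace.euclideanHausdorffMeasure_eq_volume,
    Measure.addHaar_image_linearMap, hdet, abs_of_pos hJ0]

theorem MeasureTheory.measure_le_of_countable_cover {X : Type*} [MeasurableSpace X]
    {μ ν : Measure X} {B : ℕ → Set X} (hB : ∀ i, MeasurableSet (B i))
    (h : ∀ i U, MeasurableSet U → U ⊆ B i → μ U ≤ ν U) {U : Set X} (hU : MeasurableSet U)
    (hUB : U ⊆ ⋃ i, B i) : μ U ≤ ν U := by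
  have hU' : U = ⋃ i, U ∩ disjointed B i := by
    rw [← inter_iUnion, iUnion_disjointed, inter_eq_left.2 hUB]
  have hm : ∀ i, MeasurableSet (U ∩ disjointed B i) := fun i => hU.inter (.disjointed hB i)
  have hd : Pairwise (Function.onFun Disjoint fun i => U ∩ disjointed B i) := fun i j hij =>
    (disjoint_disjointed B hij).mono inter_subset_right inter_subset_right
  rw [hU', measure_iUnion hd hm, measure_iUnion hd hm]
  exact ENNReal.tsum_le_tsum fun i =>
    h i _ (hm i) (inter_subset_right.trans (disjointed_subset B i))

theorem dist_inv_norm_smul_le {E : Type*} [NormedAddCommGroup E] [InnerProductSpace ℝ E] {x y : E}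
    (hx : 1 ≤ ‖x‖) (hy : 1 ≤ ‖y‖) : dist (‖x‖⁻¹ • x) (‖y‖⁻¹ • y) ≤ dist x y := by
  have hx0 : 0 < ‖x‖ := by linarith
  have hy0 : 0 < ‖y‖ := by linarith
  rw [dist_eq_norm, dist_eq_norm, ← sq_le_sq₀ (norm_nonneg _) (norm_nonneg _), norm_sub_sq_real,
    norm_sub_sq_real, norm_smul, norm_smul, real_inner_smul_left, real_inner_smul_right]
  simp only [norm_inv, norm_norm]
  rw [inv_mul_cancel₀ hx0.ne', inv_mul_cancel₀ hy0.ne']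
  have h1 : ⟪x, y⟫ ≤ ‖x‖ * ‖y‖ := real_inner_le_norm x y
  have h2 : ‖x‖⁻¹ * (‖y‖⁻¹ * ⟪x, y⟫) = ⟪x, y⟫ / (‖x‖ * ‖y‖) := by field_simp
  rw [h2]
  have h3 : 1 ≤ ‖x‖ * ‖y‖ := by nlinarith
  have h4 : ⟪x, y⟫ / (‖x‖ * ‖y‖) ≤ 1 := (div_le_one (by positivity)).2 h1
  have h5 : ⟪x, y⟫ = ⟪x, y⟫ / (‖x‖ * ‖y‖) * (‖x‖ * ‖y‖) := by field_simp
  set q := ⟪x, y⟫ / (‖x‖ * ‖y‖)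
  rw [h5]
  nlinarith [sq_nonneg (‖x‖ - ‖y‖), mul_nonneg (sub_nonneg.2 h4) (sub_nonneg.2 h3)]

theorem lintegral_pow_Ioo (m : ℕ) {r : ℝ} (hr : 0 ≤ r) :
    ∫⁻ t in Ioo 0 r, ENNReal.ofReal (t ^ m) = ENNReal.ofReal (r ^ (m + 1) / (m + 1)) := by
  rw [← ofReal_integral_eq_lintegral_ofReal]
  · rw [← integral_Ioc_eq_integral_Ioo, ← intervalIntegral.integral_of_le hr, integral_pow]
    simp
  · exact ((continuous_pow m).integrableOn_Icc).mono_set Ioo_subset_Icc_self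
  · filter_upwards [ae_restrict_mem measurableSet_Ioo] with t ht
    exact pow_nonneg ht.1.le m

/-- Cone over a subset of the unit sphere, as a measure of the base. -/
def sphereConeMeasure (m : ℕ) : Measure (EuclideanSpace ℝ (Fin (m + 1))) :=
  (volume.restrict (ball 0 1)).map fun y => ‖y‖⁻¹ • y

theorem measurable_inv_norm_smul (m : ℕ) :
    Measurable fun y : EuclideanSpace ℝ (Fin m) => ‖y‖⁻¹ • y := by fun_prop

theorem sphereConeMeasure_apply {m : ℕ} {U : Set (EuclideanSpace ℝ (Fin (m + 1)))}
    (hU : MeasurableSet U) :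
    sphereConeMeasure m U = volume {y | ‖y‖ < 1 ∧ ‖y‖⁻¹ • y ∈ U} := by
  rw [sphereConeMeasure, Measure.map_apply (measurable_inv_norm_smul _) hU,
    Measure.restrict_apply (measurable_inv_norm_smul _ hU)]
  congr 1
  ext y
  simp [and_comm]

theorem euclideanHausdorffMeasure_le_of_subset_sphere_inter_ball {m : ℕ}
    {p : EuclideanSpace ℝ (Fin (m + 1))} (hp : ‖p‖ = 1) {δ : ℝ} (hδ0 : 0 < δ) (hδ1 : δ < 1)
    {U : Set (EuclideanSpace ℝ (Fin (m + 1)))} (hU : MeasurableSet U)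
    (hUS : U ⊆ sphere 0 1 ∩ ball p δ) :
    ENNReal.ofReal ((1 - δ) ^ (m + 1) / (m + 1)) * μHE[m] U ≤ sphereConeMeasure m U := by
  obtain ⟨ι, hι⟩ := exists_isFrame hp
  have hinner : ∀ u ∈ U, 1 - δ < ⟪u, p⟫ := by
    intro u hu
    obtain ⟨h1, h2⟩ := hUS hu
    rw [mem_sphere_zero_iff_norm] at h1
    rw [mem_ball, dist_eq_norm] at h2
    have := norm_sub_sq_real u p
    rw [h1, hp] at this
    nlinarith [norm_nonneg (u - p)]
  set f : EuclideanSpace ℝ (Fin m) → EuclideanSpace ℝ (Fin (m + 1)) :=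
    fun x => ‖ι x + p‖⁻¹ • (ι x + p) with hf
  have hone : ∀ x, 1 ≤ ‖ι x + p‖ := by
    intro x
    have := hι.norm_add_smul_sq x 1
    rw [one_smul] at this
    nlinarith [norm_nonneg (ι x + p), norm_nonneg x]
  have hfm : Measurable f :=
    (measurable_inv_norm_smul _).comp (by fun_prop : Measurable fun x => ι x + p)
  have hfL : LipschitzWith 1 f := LipschitzWith.of_dist_le_mul fun x y => by
    refine (dist_inv_norm_smul_le (hone x) (hone y)).trans_eq ?_
    rw [dist_add_right, ι.isometry.dist_eq]
    simp
  set Z := f ⁻¹' U with hZ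
  have hUZ : U ⊆ f '' Z := by
    intro u hu
    obtain ⟨x₀, hx₀⟩ := hι.exists_eq u
    have hs : 0 < ⟪u, p⟫ := by linarith [hinner u hu]
    set s := ⟪u, p⟫
    have hτ : ι (s⁻¹ • x₀) + p = s⁻¹ • u := by
      rw [hx₀, smul_add, smul_smul, inv_mul_cancel₀ hs.ne', one_smul, map_smul]
    have hu1 : ‖u‖ = 1 := mem_sphere_zero_iff_norm.1 (hUS hu).1
    have hfu : f (s⁻¹ • x₀) = u := by
      rw [hf]
      simp only
      rw [hτ, norm_smul, hu1, mul_one, norm_inv, Real.norm_of_nonneg hs.le, inv_inv, smul_smul,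
        mul_inv_cancel₀ hs.ne', one_smul]
    exact ⟨_, by rw [hZ, mem_preimage, hfu]; exact hu, hfu⟩
  have hUle : μHE[m] U ≤ volume Z := by
    refine (measure_mono hUZ).trans ?_
    have := hfL.lipschitzOnWith (s := Z) |>.euclideanHausdorffMeasure_image_le m
    simpa [EuclideanSpace.euclideanHausdorffMeasure_eq_volume] using this
  refine (mul_le_mul_right hUle _).trans ?_
  rw [sphereConeMeasure_apply hU]
  have hCm : MeasurableSet {y : EuclideanSpace ℝ (Fin (m + 1)) | ‖y‖ < 1 ∧ ‖y‖⁻¹ • y ∈ U} :=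
    (measurableSet_lt measurable_norm measurable_const).inter (measurable_inv_norm_smul _ hU)
  rw [← hι.measurePreserving.measure_preimage hCm.nullMeasurableSet, Measure.volume_eq_prod,
    Measure.prod_apply_symm (hι.measurePreserving.measurable hCm), ← lintegral_pow_Ioo m (by linarith),
    ← lintegral_mul_const _ (by fun_prop)]
  refine le_trans ?_ (setLIntegral_le_lintegral (Ioo 0 (1 - δ)) _)
  refine setLIntegral_mono' measurableSet_Ioo fun t ht => ?_
  have : ENNReal.ofReal (t ^ m) * volume Z = volume (t • Z) := by
    rw [Measure.addHaar_smul, finrank_euclideanSpace_fin, abs_of_pos (pow_pos ht.1 m)]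
  rw [this]
  refine measure_mono ?_
  rintro _ ⟨z, hz, rfl⟩
  have hpos : 0 < ‖ι z + p‖ := by linarith [hone z]
  have hfz : f z ∈ U := hz
  have hzp : ι (t • z) + t • p = t • (ι z + p) := by rw [smul_add, map_smul]
  simp only [mem_preimage, mem_ofPred_eq]
  rw [hzp, norm_smul, Real.norm_of_nonneg ht.1.le, mul_inv, smul_smul, mul_right_comm,
    inv_mul_cancel₀ ht.1.ne', one_mul]
  refine ⟨?_, hfz⟩
  have h1 := hinner _ hfz
  rw [hf] at h1
  simp only [real_inner_smul_left] at h1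
  have h2 : ⟪ι z + p, p⟫ = 1 := by simpa using hι.inner_add_smul z 1
  rw [h2, mul_one] at h1
  calc t * ‖ι z + p‖ < ‖ι z + p‖⁻¹ * ‖ι z + p‖ := by gcongr; exact ht.2.trans h1
    _ = 1 := inv_mul_cancel₀ hpos.ne'

theorem euclideanHausdorffMeasure_le_of_subset_sphere {m : ℕ}
    {U : Set (EuclideanSpace ℝ (Fin (m + 1)))} (hU : MeasurableSet U) (hUS : U ⊆ sphere 0 1) :
    μHE[m] U ≤ (m + 1 : ℕ) * sphereConeMeasure m U := by
  rcases U.eq_empty_or_nonempty with rfl | ⟨u, hu⟩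
  · simp
  have : Nonempty (sphere (0 : EuclideanSpace ℝ (Fin (m + 1))) 1) := ⟨u, hUS hu⟩
  set q := TopologicalSpace.denseSeq (sphere (0 : EuclideanSpace ℝ (Fin (m + 1))) 1)
  have key : ∀ δ ∈ Ioo (0 : ℝ) 1,
      ENNReal.ofReal ((1 - δ) ^ (m + 1) / (m + 1)) * μHE[m] U ≤ sphereConeMeasure m U := by
    intro δ hδ
    refine measure_le_of_countable_cover
      (μ := ENNReal.ofReal ((1 - δ) ^ (m + 1) / (m + 1)) • μHE[m])
      (B := fun i => sphere 0 1 ∩ ball (q i : EuclideanSpace ℝ (Fin (m + 1))) δ)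
      (fun i => isClosed_sphere.measurableSet.inter measurableSet_ball)
      (fun i V hV hVB => euclideanHausdorffMeasure_le_of_subset_sphere_inter_ball
        (mem_sphere_zero_iff_norm.1 (q i).2) hδ.1 hδ.2 hV hVB) hU fun x hx => ?_
    obtain ⟨i, hi⟩ := (TopologicalSpace.denseRange_denseSeq _).exists_dist_lt
      (⟨x, hUS hx⟩ : sphere (0 : EuclideanSpace ℝ (Fin (m + 1))) 1) hδ.1
    exact mem_iUnion.2 ⟨i, hUS hx, hi⟩
  have hlim : Tendsto (fun δ : ℝ => ENNReal.ofReal ((1 - δ) ^ (m + 1) / (m + 1)) * μHE[m] U)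
      (𝓝[>] 0) (𝓝 (ENNReal.ofReal ((1 - 0) ^ (m + 1) / (m + 1)) * μHE[m] U)) := by
    refine ENNReal.Tendsto.mul_const ?_ (Or.inl (by simp; positivity))
    refine ENNReal.tendsto_ofReal ?_
    exact ((by fun_prop : Continuous fun δ : ℝ => (1 - δ) ^ (m + 1) / (m + 1)).tendsto 0).mono_left
      nhdsWithin_le_nhds
  have := le_of_tendsto hlim (by
    filter_upwards [Ioo_mem_nhdsGT one_pos] with δ hδ using key δ hδ)
  refine le_trans (le_of_eq ?_) (mul_le_mul_right this _)
  rw [← mul_assoc, ← ENNReal.ofReal_natCast, ← ENNReal.ofReal_mul (by positivity)]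
  push_cast
  rw [sub_zero, one_pow, mul_one_div_cancel (by positivity), ENNReal.ofReal_one, one_mul]

theorem euclideanHausdorffMeasure_image_le_image {X Y Z : Type*} [EMetricSpace X]
    [MeasurableSpace X] [BorelSpace X] [EMetricSpace Y] [MeasurableSpace Y] [BorelSpace Y]
    {K : ℝ≥0} {f : Z → Y} {g : Z → X} {s : Set Z}
    (h : ∀ x ∈ s, ∀ y ∈ s, edist (f x) (f y) ≤ K * edist (g x) (g y)) (d : ℕ) :
    μHE[d] (f '' s) ≤ (K : ℝ≥0∞) ^ d * μHE[d] (g '' s) := by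
  rcases isEmpty_or_nonempty Z with hZ | hZ
  · simp [Set.eq_empty_of_isEmpty s]
  have hmem : ∀ p ∈ g '' s, Function.invFunOn g s p ∈ s := fun p hp => Function.invFunOn_mem hp
  have heq : ∀ p ∈ g '' s, g (Function.invFunOn g s p) = p := fun p hp => Function.invFunOn_eq hp
  have hL : LipschitzOnWith K (f ∘ Function.invFunOn g s) (g '' s) := by
    intro p hp q hq
    have := h _ (hmem p hp) _ (hmem q hq)
    rwa [heq p hp, heq q hq] at this
  refine le_trans (measure_mono ?_) (hL.euclideanHausdorffMeasure_image_le d)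
  rintro _ ⟨x, hx, rfl⟩
  refine ⟨g x, mem_image_of_mem g hx, edist_le_zero.1 ?_⟩
  have := h _ (hmem (g x) (mem_image_of_mem g hx)) x hx
  rwa [heq (g x) (mem_image_of_mem g hx), edist_self, mul_zero] at this

/-- The area element of the graph of `φ`. -/
def graphJacobian {F : Type*} [NormedAddCommGroup F] [NormedSpace ℝ F] (φ : F → ℝ)
    (x : F) : ℝ :=
  √(1 + ‖fderiv ℝ φ x‖ ^ 2)

theorem sqrt_one_add_sq_le_mul {a b ε : ℝ} (ha : 0 ≤ a) (hε : 0 ≤ ε) (h : b ≤ a + ε)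
    (hb : 0 ≤ b) : √(1 + b ^ 2) ≤ (1 + ε) * √(1 + a ^ 2) := by
  have hs : √(1 + a ^ 2) ^ 2 = 1 + a ^ 2 := Real.sq_sqrt (by positivity)
  have h1 : 1 ≤ √(1 + a ^ 2) := Real.one_le_sqrt.2 (by nlinarith)
  have h2 : a ≤ √(1 + a ^ 2) := Real.le_sqrt_of_sq_le (by linarith)
  rw [Real.sqrt_le_left (by positivity), mul_pow, hs]
  nlinarith [mul_nonneg hε ha, mul_nonneg hε hε, sq_nonneg (a - 1), mul_nonneg hε (sq_nonneg (a-1)),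
    mul_nonneg (mul_nonneg hε hε) (sq_nonneg a)]

namespace IsFrame

variable {m : ℕ} {ι : EuclideanSpace ℝ (Fin m) →ₗᵢ[ℝ] EuclideanSpace ℝ (Fin (m + 1))}
  {v : EuclideanSpace ℝ (Fin (m + 1))}

theorem graph_injective (h : IsFrame ι v) (φ : EuclideanSpace ℝ (Fin m) → ℝ) :
    Function.Injective fun x => ι x + φ x • v := by
  intro x y hxy
  have : φ x = φ y := by
    rw [← h.inner_add_smul x (φ x), ← h.inner_add_smul y (φ y)]
    exact congrArg (fun z => ⟪z, v⟫) hxy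
  simpa [this] using hxy

theorem measurableEmbedding_graph (h : IsFrame ι v) {φ : EuclideanSpace ℝ (Fin m) → ℝ}
    (hφ : Continuous φ) : MeasurableEmbedding fun x => ι x + φ x • v :=
  Continuous.measurableEmbedding (by fun_prop) (h.graph_injective φ)

theorem withDensity_graphJacobian_le_of_approximatesLinearOn (h : IsFrame ι v)
    {φ : EuclideanSpace ℝ (Fin m) → ℝ} (A : EuclideanSpace ℝ (Fin m) →L[ℝ] ℝ) {ε : ℝ≥0}
    {W : Set (EuclideanSpace ℝ (Fin m))} (hW : MeasurableSet W)
    (hA : ApproximatesLinearOn φ A W ε) (hd : ∀ x ∈ W, ‖fderiv ℝ φ x - A‖ ≤ ε) :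
    volume.withDensity (fun x => ENNReal.ofReal (graphJacobian φ x)) W ≤
      (1 + ε : ℝ≥0) ^ (m + 1) * μHE[m] ((fun x => ι x + φ x • v) '' W) := by
  set L : EuclideanSpace ℝ (Fin m) →ₗ[ℝ] EuclideanSpace ℝ (Fin (m + 1)) :=
    ι.toLinearMap + (A : EuclideanSpace ℝ (Fin m) →ₗ[ℝ] ℝ).smulRight v with hLdef
  have hLx : ∀ x, L x = ι x + A x • v := fun x => rfl
  set a := (InnerProductSpace.toDual ℝ (EuclideanSpace ℝ (Fin m))).symm A with ha
  have hax : ∀ x, ⟪a, x⟫ = A x := fun x => by rw [ha, InnerProductSpace.toDual_symm_apply]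
  have hLn := euclideanHausdorffMeasure_image_linearMap a L
    (fun x => by rw [hLx, h.norm_add_smul_sq, hax]) W
  have hna : ‖a‖ = ‖A‖ := by rw [ha, LinearIsometryEquiv.norm_map]
  rw [hna] at hLn
  have hcomp : μHE[m] (L '' W) ≤
      ((1 + ε : ℝ≥0) : ℝ≥0∞) ^ m * μHE[m] ((fun x => ι x + φ x • v) '' W) := by
    refine euclideanHausdorffMeasure_image_le_image (fun x hx y hy => ?_) m
    rw [edist_dist, edist_dist, ← ENNReal.ofReal_coe_nnreal, ← ENNReal.ofReal_mul (by positivity)]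
    refine ENNReal.ofReal_le_ofReal ?_
    rw [dist_eq_norm, dist_eq_norm]
    have e1 : ι x + φ x • v - (ι y + φ y • v) = ι (x - y) + (φ x - φ y) • v := by
      rw [map_sub]; module
    have e2 : L x - L y = (ι (x - y) + (φ x - φ y) • v) - (φ x - φ y - A (x - y)) • v := by
      rw [← map_sub, hLx]; module
    have h1 := hA x hx y hy
    have h2 := h.norm_le_norm_add_smul (x - y) (φ x - φ y)
    rw [e1, e2]
    refine (norm_sub_le _ _).trans ?_
    rw [norm_smul, h.norm_eq_one, mul_one]
    push_cast
    nlinarith [mul_le_mul_of_nonneg_left h2 ε.2]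
  have hJ : ∀ x ∈ W, ENNReal.ofReal (graphJacobian φ x) ≤
      (1 + ε : ℝ≥0) * ENNReal.ofReal (√(1 + ‖A‖ ^ 2)) := by
    intro x hx
    rw [← ENNReal.ofReal_coe_nnreal, ← ENNReal.ofReal_mul (by positivity)]
    refine ENNReal.ofReal_le_ofReal ?_
    push_cast
    refine sqrt_one_add_sq_le_mul (norm_nonneg _) ε.2 ?_ (norm_nonneg _)
    have := norm_sub_norm_le (fderiv ℝ φ x) A
    have := hd x hx
    linarith
  rw [withDensity_apply _ hW]
  calc ∫⁻ x in W, ENNReal.ofReal (graphJacobian φ x)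
      ≤ ∫⁻ x in W, (1 + ε : ℝ≥0) * ENNReal.ofReal (√(1 + ‖A‖ ^ 2)) := setLIntegral_mono' hW hJ
    _ = (1 + ε : ℝ≥0) * μHE[m] (L '' W) := by
      rw [lintegral_const, Measure.restrict_apply_univ, hLn, mul_assoc]
    _ ≤ _ := by
      rw [pow_succ', mul_assoc]
      exact mul_le_mul_right hcomp _

theorem withDensity_graphJacobian_le_mul (h : IsFrame ι v)
    {φ : EuclideanSpace ℝ (Fin m) → ℝ} {K : ℝ≥0} (hφ : LipschitzWith K φ) {ε : ℝ≥0} (hε : 0 < ε)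
    {T : Set (EuclideanSpace ℝ (Fin m))} (hT : MeasurableSet T)
    (hdT : ∀ x ∈ T, DifferentiableAt ℝ φ x) :
    volume.withDensity (fun x => ENNReal.ofReal (graphJacobian φ x)) T ≤
      (1 + ε : ℝ≥0) ^ (m + 1) * μHE[m] ((fun x => ι x + φ x • v) '' T) := by
  set G := fun x => ι x + φ x • v
  have hG : MeasurableEmbedding G := h.measurableEmbedding_graph hφ.continuous
  set ν : Measure (EuclideanSpace ℝ (Fin m)) :=
    ((1 + ε : ℝ≥0) : ℝ≥0∞) ^ (m + 1) • (μHE[m]).comap G with hν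
  have hνU : ∀ U, ν U = ((1 + ε : ℝ≥0) : ℝ≥0∞) ^ (m + 1) * μHE[m] (G '' U) := fun U => by
    rw [hν, Measure.smul_apply, hG.comap_apply, smul_eq_mul]
  rw [← hνU]
  set a := TopologicalSpace.denseSeq (EuclideanSpace ℝ (Fin m) →L[ℝ] ℝ)
  refine measure_le_of_countable_cover
    (B := fun k => {x | DifferentiableAt ℝ φ x} ∩ {x | ‖fderiv ℝ φ x - a k‖ < ε / 2})
    (fun k => (measurableSet_of_differentiableAt ℝ φ).inter
      (measurableSet_lt ((measurable_fderiv ℝ φ).sub_const _).norm measurable_const))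
    (fun k U hU hUk => ?_) hT fun x hx => ?_
  · rcases U.eq_empty_or_nonempty with rfl | hne
    · simp
    obtain ⟨t, A, -, htm, htc, htA, hA⟩ :=
      exists_partition_approximatesLinearOn_of_hasFDerivWithinAt φ U (fderiv ℝ φ)
        (fun x hx => (hUk hx).1.hasFDerivAt.hasFDerivWithinAt) (fun _ => ε) (fun _ => hε.ne')
    refine measure_le_of_countable_cover (B := fun n => U ∩ t n) (fun n => hU.inter (htm n))
      (fun n W hW hWn => ?_) hU (fun x hx => ?_)
    · rw [hνU]
      refine h.withDensity_graphJacobian_le_of_approximatesLinearOn (A n) hW ((htA n).mono_set hWn)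
        fun x hx => ?_
      obtain ⟨y, hy, hAy⟩ := hA hne n
      rw [hAy]
      have h1 : ‖fderiv ℝ φ x - a k‖ < ε / 2 := (hUk (hWn hx).1).2
      have h2 : ‖fderiv ℝ φ y - a k‖ < ε / 2 := (hUk hy).2
      have := norm_sub_le (fderiv ℝ φ x - a k) (fderiv ℝ φ y - a k)
      rw [sub_sub_sub_cancel_right] at this
      linarith
    · rw [← inter_iUnion]
      exact ⟨hx, htc hx⟩
  · obtain ⟨k, hk⟩ := (TopologicalSpace.denseRange_denseSeq
      (EuclideanSpace ℝ (Fin m) →L[ℝ] ℝ)).exists_dist_lt (fderiv ℝ φ x)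
      (show (0 : ℝ) < ε / 2 by positivity)
    rw [dist_eq_norm] at hk
    exact mem_iUnion.2 ⟨k, hdT x hx, hk⟩

theorem lintegral_graphJacobian_le (h : IsFrame ι v)
    {φ : EuclideanSpace ℝ (Fin m) → ℝ} {K : ℝ≥0} (hφ : LipschitzWith K φ)
    {T : Set (EuclideanSpace ℝ (Fin m))} (hT : MeasurableSet T) :
    ∫⁻ x in T, ENNReal.ofReal (graphJacobian φ x) ≤ μHE[m] ((fun x => ι x + φ x • v) '' T) := by
  set D := {x | DifferentiableAt ℝ φ x}
  have hD : MeasurableSet D := measurableSet_of_differentiableAt ℝ φ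
  have hae : (T ∩ D : Set _) =ᵐ[volume] T := by
    filter_upwards [hφ.ae_differentiableAt (μ := volume)] with x hx
    exact propext ⟨fun h => h.1, fun h => ⟨h, hx⟩⟩
  rw [← setLIntegral_congr hae]
  refine le_trans ?_ (measure_mono (image_mono (inter_subset_left : T ∩ D ⊆ T)))
  have key : ∀ ε : ℝ≥0, 0 < ε → _ := fun ε hε =>
    h.withDensity_graphJacobian_le_mul hφ hε (hT.inter hD) fun x hx => hx.2
  rw [withDensity_apply _ (hT.inter hD)] at key
  have hlim : Tendsto (fun ε : ℝ≥0 => ((1 + ε : ℝ≥0) : ℝ≥0∞) ^ (m + 1) *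
      μHE[m] ((fun x => ι x + φ x • v) '' (T ∩ D))) (𝓝[>] 0)
      (𝓝 (((1 + 0 : ℝ≥0) : ℝ≥0∞) ^ (m + 1) * μHE[m] ((fun x => ι x + φ x • v) '' (T ∩ D)))) := by
    refine ENNReal.Tendsto.mul_const ?_ (Or.inl (by simp))
    simp only [← ENNReal.coe_pow]
    refine ENNReal.tendsto_coe.2 ?_
    exact ((by fun_prop : Continuous fun ε : ℝ≥0 => (1 + ε) ^ (m + 1)).tendsto 0).mono_left
      nhdsWithin_le_nhds
  have := ge_of_tendsto hlim (by
    filter_upwards [self_mem_nhdsWithin] with ε hε using key ε hε)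
  simpa using this

end IsFrame

namespace IsFrame

variable {m : ℕ} {ι : EuclideanSpace ℝ (Fin m) →ₗᵢ[ℝ] EuclideanSpace ℝ (Fin (m + 1))}
  {v p : EuclideanSpace ℝ (Fin (m + 1))} {Ω S Q : Set (EuclideanSpace ℝ (Fin (m + 1)))}
  {ψ : EuclideanSpace ℝ (Fin m) → ℝ} {r t : ℝ} {K : ℝ≥0} {x : EuclideanSpace ℝ (Fin m)} {h : ℝ}

theorem exists_of_mem_thickening (hι : IsFrame ι v)
    (hloc : ∀ x h, ι x + h • v ∈ ball p r → (ι x + h • v ∈ Ω ↔ ψ x < h)) (ht : t < r / 2)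
    (hy : ι x + h • v ∈ ball p (r / 2)) (hyΩ : ι x + h • v ∉ Ω)
    (hyt : ι x + h • v ∈ thickening t Ω) :
    h ≤ ψ x ∧ ∃ z w, ‖z‖ ^ 2 + w ^ 2 < t ^ 2 ∧ ψ (x + z) < h + w := by
  obtain ⟨ω, hω, hyω⟩ := mem_thickening_iff.1 hyt
  have ht0 : 0 ≤ t := dist_nonneg.trans hyω.le
  have hyr : ι x + h • v ∈ ball p r := ball_subset_ball (by linarith) hy
  refine ⟨not_lt.1 fun hlt => hyΩ ((hloc x h hyr).2 hlt), ?_⟩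
  obtain ⟨x', hx'⟩ := hι.exists_eq ω
  set h' := ⟪ω, v⟫
  have hωr : ι x' + h' • v ∈ ball p r := by
    rw [← hx', mem_ball]
    rw [mem_ball] at hy
    linarith [dist_triangle_left ω p (ι x + h • v)]
  refine ⟨x' - x, h' - h, ?_, ?_⟩
  · have e : ω - (ι x + h • v) = ι (x' - x) + (h' - h) • v := by
      rw [hx', map_sub]; module
    rw [← hι.norm_add_smul_sq, ← e, ← dist_eq_norm, dist_comm]
    exact pow_lt_pow_left₀ hyω dist_nonneg two_ne_zero
  · rw [add_sub_cancel, add_sub_cancel]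
    exact (hloc x' h' hωr).1 (hx' ▸ hω)

theorem sub_le_of_mem_thickening (hι : IsFrame ι v) (hψ : LipschitzWith K ψ)
    (hloc : ∀ x h, ι x + h • v ∈ ball p r → (ι x + h • v ∈ Ω ↔ ψ x < h)) (ht0 : 0 < t)
    (ht : t < r / 2) (hy : ι x + h • v ∈ ball p (r / 2)) (hyΩ : ι x + h • v ∉ Ω)
    (hyt : ι x + h • v ∈ thickening t Ω) : h ≤ ψ x ∧ ψ x - h ≤ (K + 1) * t := by
  obtain ⟨h1, z, w, hzw, h2⟩ := hι.exists_of_mem_thickening hloc ht hy hyΩ hyt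
  refine ⟨h1, ?_⟩
  have hz : ‖z‖ ≤ t := abs_le_of_sq_le_sq' (by nlinarith) ht0.le |>.2
  have hw : w ≤ t := abs_le_of_sq_le_sq' (by nlinarith [sq_nonneg ‖z‖]) ht0.le |>.2
  have := hψ.dist_le_mul x (x + z)
  rw [dist_self_add_right, Real.dist_eq] at this
  nlinarith [le_abs_self (ψ x - ψ (x + z)), mul_le_mul_of_nonneg_left hz K.2]

theorem eventually_sub_le_of_mem_thickening (hι : IsFrame ι v)
    (hloc : ∀ x h, ι x + h • v ∈ ball p r → (ι x + h • v ∈ Ω ↔ ψ x < h))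
    (hd : DifferentiableAt ℝ ψ x) {ε : ℝ} (hε : 0 < ε) :
    ∀ᶠ t in 𝓝[>] (0 : ℝ), t < r / 2 → ∀ h, ι x + h • v ∈ ball p (r / 2) → ι x + h • v ∉ Ω →
      ι x + h • v ∈ thickening t Ω → ψ x - h ≤ (graphJacobian ψ x + ε) * t := by
  have hA := (hasFDerivAt_iff_isLittleO_nhds_zero.1 hd.hasFDerivAt).def hε
  obtain ⟨δ, hδ, hδA⟩ := Metric.eventually_nhds_iff.1 hA
  filter_upwards [Ioo_mem_nhdsGT hδ] with t ht htr h hy hyΩ hyt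
  obtain ⟨h1, z, w, hzw, h2⟩ := hι.exists_of_mem_thickening hloc htr hy hyΩ hyt
  set A := fderiv ℝ ψ x
  have hz : ‖z‖ ≤ t := abs_le_of_sq_le_sq' (by nlinarith) ht.1.le |>.2
  have h3 := hδA (y := z) (by rw [dist_zero_right]; exact hz.trans_lt ht.2)
  have h4 := (abs_le.1 h3).1
  have h5 := (abs_le.1 (A.le_opNorm z)).1
  have h6 : w + ‖A‖ * ‖z‖ ≤ graphJacobian ψ x * t := by
    have hJ : graphJacobian ψ x ^ 2 = 1 + ‖A‖ ^ 2 := Real.sq_sqrt (by positivity)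
    have hJ0 : 0 ≤ graphJacobian ψ x := Real.sqrt_nonneg _
    refine abs_le_of_sq_le_sq' ?_ (mul_nonneg hJ0 ht.1.le) |>.2
    rw [mul_pow, hJ]
    nlinarith [sq_nonneg (‖A‖ * w - ‖z‖), sq_nonneg ‖A‖]
  nlinarith [mul_le_mul_of_nonneg_left hz hε.le]

theorem mem_frontier_of_forall_exists (hι : IsFrame ι v) (hψ : LipschitzWith K ψ)
    (hSc : Convex ℝ S) (hΩS : Ω ⊆ S)
    (hloc : ∀ x h, ι x + h • v ∈ ball p r → (ι x + h • v ∈ Ω ↔ ψ x < h)) (hr : 0 < r)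
    (hQ : Q ⊆ ball p (r / 2))
    (H : ∀ δ > 0, ∃ t ∈ Ioo 0 δ, ∃ h : ℝ, ι x + h • v ∈ (S \ Ω) ∩ thickening t Ω ∩ Q) :
    ι x + ψ x • v ∈ S ∩ frontier Ω ∩ closure Q := by
  have hbound : ∀ t, 0 < t → t < r / 2 → ∀ h : ℝ, ι x + h • v ∈ (S \ Ω) ∩ thickening t Ω ∩ Q →
      h ≤ ψ x ∧ ψ x - h ≤ (K + 1) * t := fun t ht0 ht h hy =>
    hι.sub_le_of_mem_thickening hψ hloc ht0 ht (hQ hy.2) hy.1.1.2 hy.1.2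
  have hdist : ∀ a b : ℝ, dist (ι x + a • v) (ι x + b • v) = |a - b| := fun a b => by
    rw [dist_add_left, dist_eq_norm, ← sub_smul, norm_smul, hι.norm_eq_one, mul_one,
      Real.norm_eq_abs]
  have hcl : ι x + ψ x • v ∈ closure Q := by
    refine Metric.mem_closure_iff.2 fun ε hε => ?_
    obtain ⟨t, ht, h, hy⟩ := H (min (r / 2) (ε / (K + 1))) (by positivity)
    obtain ⟨h1, h2⟩ := hbound t ht.1 (ht.2.trans_le (min_le_left _ _)) h hy
    refine ⟨_, hy.2, ?_⟩
    rw [hdist, abs_of_nonneg (by linarith)]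
    have : t < ε / (K + 1) := ht.2.trans_le (min_le_right _ _)
    rw [lt_div_iff₀ (by positivity)] at this
    linarith
  have hG : ι x + ψ x • v ∈ ball p r := by
    have := closure_minimal (hQ.trans ball_subset_closedBall) isClosed_closedBall hcl
    exact closedBall_subset_ball (by linarith) this
  have hup : ∀ᶠ s in 𝓝[>] (0 : ℝ), ι x + (ψ x + s) • v ∈ Ω := by
    have hc : Tendsto (fun s : ℝ => ι x + (ψ x + s) • v) (𝓝[>] 0) (𝓝 (ι x + (ψ x + 0) • v)) :=
      ((by fun_prop : Continuous fun s : ℝ => ι x + (ψ x + s) • v).tendsto 0).mono_left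
        nhdsWithin_le_nhds
    rw [add_zero] at hc
    filter_upwards [hc (isOpen_ball.mem_nhds hG), self_mem_nhdsWithin] with s hs hs0
    exact (hloc x (ψ x + s) hs).2 (lt_add_of_pos_right _ hs0)
  have hnot : ι x + ψ x • v ∉ Ω := fun hmem => lt_irrefl _ ((hloc _ _ hG).1 hmem)
  refine ⟨⟨?_, ?_⟩, hcl⟩
  · obtain ⟨t, ht, h, hy⟩ := H (r / 2) (by positivity)
    have h1 := (hbound t ht.1 ht.2 h hy).1
    obtain ⟨s, hs, hs0⟩ := (hup.and self_mem_nhdsWithin).exists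
    have hs0 : 0 < s := hs0
    have hpos : 0 < ψ x + s - h := by linarith
    have := hSc hy.1.1.1 (hΩS hs) (a := s / (ψ x + s - h)) (b := (ψ x - h) / (ψ x + s - h))
      (by positivity) (div_nonneg (by linarith) hpos.le) (by field_simp; ring)
    convert this using 1
    have e1 : (1 : ℝ) = s / (ψ x + s - h) + (ψ x - h) / (ψ x + s - h) := by field_simp; ring
    have e2 : ψ x = s / (ψ x + s - h) * h + (ψ x - h) / (ψ x + s - h) * (ψ x + s) := by
      field_simp; ring
    rw [smul_add, smul_add, add_add_add_comm, ← add_smul, ← e1, one_smul, smul_smul, smul_smul,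
      ← add_smul, ← e2]
  · refine ⟨?_, fun hy => hnot (interior_subset hy)⟩
    refine mem_closure_of_tendsto (b := 𝓝[>] (0 : ℝ)) ?_ hup
    have : Tendsto (fun s : ℝ => ι x + (ψ x + s) • v) (𝓝 0) (𝓝 (ι x + (ψ x + 0) • v)) :=
      (by fun_prop : Continuous fun s : ℝ => ι x + (ψ x + s) • v).tendsto 0
    rw [add_zero] at this
    exact this.mono_left nhdsWithin_le_nhds

end IsFrame

namespace IsFrame

variable {m : ℕ} {ι : EuclideanSpace ℝ (Fin m) →ₗᵢ[ℝ] EuclideanSpace ℝ (Fin (m + 1))}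
  {v p : EuclideanSpace ℝ (Fin (m + 1))} {Ω S Q : Set (EuclideanSpace ℝ (Fin (m + 1)))}
  {ψ : EuclideanSpace ℝ (Fin m) → ℝ} {r : ℝ} {K : ℝ≥0}

theorem limsup_volume_slice_le (hι : IsFrame ι v) (hψ : LipschitzWith K ψ)
    (hSc : Convex ℝ S) (hΩS : Ω ⊆ S)
    (hloc : ∀ x h, ι x + h • v ∈ ball p r → (ι x + h • v ∈ Ω ↔ ψ x < h)) (hr : 0 < r)
    (hQ : Q ⊆ ball p (r / 2)) {t : ℕ → ℝ} (ht0 : ∀ k, 0 < t k) (ht : ∀ k, t k < r / 2)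
    (hlim : Tendsto t atTop (𝓝 0)) {x : EuclideanSpace ℝ (Fin m)} (hd : DifferentiableAt ℝ ψ x) :
    limsup (fun k => volume {h : ℝ | ι x + h • v ∈ (S \ Ω) ∩ thickening (t k) Ω ∩ Q} /
        ENNReal.ofReal (t k)) atTop ≤
      ((fun x => ι x + ψ x • v) ⁻¹' (S ∩ frontier Ω ∩ closure Q)).indicator
        (fun x => ENNReal.ofReal (graphJacobian ψ x)) x := by
  have hlim' : Tendsto t atTop (𝓝[>] 0) :=
    tendsto_nhdsWithin_iff.2 ⟨hlim, Eventually.of_forall ht0⟩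
  by_cases hx : ι x + ψ x • v ∈ S ∩ frontier Ω ∩ closure Q
  · rw [indicator_of_mem (by exact hx)]
    have key : ∀ ε : ℝ, 0 < ε → limsup (fun k =>
        volume {h : ℝ | ι x + h • v ∈ (S \ Ω) ∩ thickening (t k) Ω ∩ Q} / ENNReal.ofReal (t k))
        atTop ≤ ENNReal.ofReal (graphJacobian ψ x + ε) := fun ε hε => by
      refine limsup_le_of_le (by isBoundedDefault) ?_
      filter_upwards [hlim'.eventually (hι.eventually_sub_le_of_mem_thickening hloc hd hε)]
        with k hk
      have hJ : 0 ≤ graphJacobian ψ x := Real.sqrt_nonneg _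
      refine ENNReal.div_le_of_le_mul ?_
      rw [← ENNReal.ofReal_mul (by positivity)]
      have hsub : {h : ℝ | ι x + h • v ∈ (S \ Ω) ∩ thickening (t k) Ω ∩ Q} ⊆
          Icc (ψ x - (graphJacobian ψ x + ε) * t k) (ψ x) := fun h hh => by
        have h1 := hk (ht k) h (hQ hh.2) hh.1.1.2 hh.1.2
        have h2 := (hι.sub_le_of_mem_thickening hψ hloc (ht0 k) (ht k) (hQ hh.2) hh.1.1.2 hh.1.2).1
        exact ⟨by linarith, h2⟩
      refine (measure_mono hsub).trans_eq ?_
      rw [Real.volume_Icc, sub_sub_cancel]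
    have hlimε : Tendsto (fun ε : ℝ => ENNReal.ofReal (graphJacobian ψ x + ε)) (𝓝[>] 0)
        (𝓝 (ENNReal.ofReal (graphJacobian ψ x + 0))) :=
      ENNReal.tendsto_ofReal (((continuous_const.add continuous_id).tendsto 0).mono_left
        nhdsWithin_le_nhds)
    rw [add_zero] at hlimε
    refine ge_of_tendsto hlimε ?_
    filter_upwards [self_mem_nhdsWithin] with ε hε using key ε hε
  · rw [indicator_of_notMem (by exact hx)]
    have : ¬ ∀ δ > 0, ∃ t ∈ Ioo 0 δ, ∃ h : ℝ, ι x + h • v ∈ (S \ Ω) ∩ thickening t Ω ∩ Q :=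
      fun H => hx (hι.mem_frontier_of_forall_exists hψ hSc hΩS hloc hr hQ H)
    push Not at this
    obtain ⟨δ, hδ, H⟩ := this
    refine limsup_le_of_le (by isBoundedDefault) ?_
    filter_upwards [hlim' (Ioo_mem_nhdsGT hδ)] with k hk
    have hempty : {h : ℝ | ι x + h • v ∈ (S \ Ω) ∩ thickening (t k) Ω ∩ Q} = ∅ :=
      eq_empty_of_forall_notMem (H (t k) hk)
    simp only [hempty, measure_empty, ENNReal.zero_div, le_refl]

theorem limsup_volume_le (hι : IsFrame ι v) (hψ : LipschitzWith K ψ)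
    (hSo : IsOpen S) (hSc : Convex ℝ S) (hΩo : IsOpen Ω) (hΩS : Ω ⊆ S)
    (hloc : ∀ x h, ι x + h • v ∈ ball p r → (ι x + h • v ∈ Ω ↔ ψ x < h)) (hr : 0 < r)
    (hQm : MeasurableSet Q) (hQ : Q ⊆ ball p (r / 2)) {t : ℕ → ℝ} (ht0 : ∀ k, 0 < t k)
    (ht : ∀ k, t k < r / 2) (hlim : Tendsto t atTop (𝓝 0)) :
    limsup (fun k => volume ((S \ Ω) ∩ thickening (t k) Ω ∩ Q) / ENNReal.ofReal (t k)) atTop ≤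
      μHE[m] (S ∩ frontier Ω ∩ closure Q) := by
  set A := S ∩ frontier Ω ∩ closure Q
  have hAm : MeasurableSet A :=
    (hSo.measurableSet.inter isClosed_frontier.measurableSet).inter isClosed_closure.measurableSet
  have hDm : ∀ k, MeasurableSet ((S \ Ω) ∩ thickening (t k) Ω ∩ Q) := fun k =>
    ((hSo.measurableSet.diff hΩo.measurableSet).inter isOpen_thickening.measurableSet).inter hQm
  have hvol : ∀ k, volume ((S \ Ω) ∩ thickening (t k) Ω ∩ Q) / ENNReal.ofReal (t k) =
      ∫⁻ x, volume {h : ℝ | ι x + h • v ∈ (S \ Ω) ∩ thickening (t k) Ω ∩ Q} /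
        ENNReal.ofReal (t k) := fun k => by
    rw [hι.volume_eq_lintegral (hDm k)]
    simp only [div_eq_mul_inv]
    rw [lintegral_mul_const']
    simpa using ht0 k
  have hm : ∀ k, Measurable fun x =>
      volume {h : ℝ | ι x + h • v ∈ (S \ Ω) ∩ thickening (t k) Ω ∩ Q} / ENNReal.ofReal (t k) :=
    fun k => (measurable_measure_prodMk_left
      (hι.measurePreserving.measurable (hDm k))).div_const _
  simp only [hvol]
  have hG : Continuous fun x => ι x + ψ x • v := by
    have := hψ.continuous
    fun_prop
  set R := ‖p‖ + r
  refine (limsup_lintegral_le ((closedBall 0 R).indicator fun _ => ENNReal.ofReal (K + 1)) hm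
    (fun k => Eventually.of_forall fun x => ?_) ?_).trans ?_
  · have hsub : {h : ℝ | ι x + h • v ∈ (S \ Ω) ∩ thickening (t k) Ω ∩ Q} ⊆
        Icc (ψ x - (K + 1) * t k) (ψ x) := fun h hh => by
      obtain ⟨h1, h2⟩ :=
        hι.sub_le_of_mem_thickening hψ hloc (ht0 k) (ht k) (hQ hh.2) hh.1.1.2 hh.1.2
      exact ⟨by linarith, h1⟩
    by_cases hxR : x ∈ closedBall 0 R
    · rw [indicator_of_mem hxR]
      refine ENNReal.div_le_of_le_mul ((measure_mono hsub).trans_eq ?_)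
      rw [Real.volume_Icc, ← ENNReal.ofReal_mul (by positivity)]
      congr 1
      ring
    · rw [indicator_of_notMem hxR]
      have hempty : {h : ℝ | ι x + h • v ∈ (S \ Ω) ∩ thickening (t k) Ω ∩ Q} = ∅ := by
        refine eq_empty_of_forall_notMem fun h hh => hxR ?_
        have h1 := hQ hh.2
        rw [mem_ball, dist_eq_norm] at h1
        rw [mem_closedBall_zero_iff]
        have := hι.norm_le_norm_add_smul x h
        have := norm_sub_norm_le (ι x + h • v) p
        linarith
      simp only [hempty, measure_empty, ENNReal.zero_div, le_refl]
  · rw [lintegral_indicator measurableSet_closedBall, setLIntegral_const]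
    exact (ENNReal.mul_lt_top ENNReal.ofReal_lt_top measure_closedBall_lt_top).ne
  · have hTm : MeasurableSet ((fun x => ι x + ψ x • v) ⁻¹' A) := hG.measurable hAm
    calc _ ≤ ∫⁻ x, ((fun x => ι x + ψ x • v) ⁻¹' A).indicator
          (fun x => ENNReal.ofReal (graphJacobian ψ x)) x := by
          refine lintegral_mono_ae ?_
          filter_upwards [hψ.ae_differentiableAt (μ := volume)] with x hx
          exact hι.limsup_volume_slice_le hψ hSc hΩS hloc hr hQ ht0 ht hlim hx
      _ ≤ μHE[m] ((fun x => ι x + ψ x • v) '' ((fun x => ι x + ψ x • v) ⁻¹' A)) := by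
          rw [lintegral_indicator hTm]
          exact hι.lintegral_graphJacobian_le hψ hTm
      _ ≤ μHE[m] A := measure_mono (image_preimage_subset _ _)

end IsFrame

namespace IsFrame

variable {m : ℕ} {ι : EuclideanSpace ℝ (Fin m) →ₗᵢ[ℝ] EuclideanSpace ℝ (Fin (m + 1))}
  {v p : EuclideanSpace ℝ (Fin (m + 1))} {Ω S Q : Set (EuclideanSpace ℝ (Fin (m + 1)))}
  {ψ : EuclideanSpace ℝ (Fin m) → ℝ} {r : ℝ} {K : ℝ≥0}

theorem euclideanHausdorffMeasure_frontier_inter_ball_lt_top (hι : IsFrame ι v)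
    (hψ : LipschitzWith K ψ) (hΩo : IsOpen Ω)
    (hloc : ∀ x h, ι x + h • v ∈ ball p r → (ι x + h • v ∈ Ω ↔ ψ x < h)) :
    μHE[m] (frontier Ω ∩ ball p (r / 2)) < ∞ := by
  rcases le_or_gt r 0 with hr | hr
  · rw [ball_eq_empty.2 (by linarith : r / 2 ≤ 0)]
    simp
  set G := fun x => ι x + ψ x • v
  have hsub : frontier Ω ∩ ball p (r / 2) ⊆ G '' closedBall 0 (‖p‖ + r) := by
    rintro y ⟨hyf, hyb⟩
    rw [hΩo.frontier_eq] at hyf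
    obtain ⟨x, hx⟩ := hι.exists_eq y
    set h := ⟪y, v⟫
    have key : ∀ t, 0 < t → t < r / 2 → h ≤ ψ x ∧ ψ x - h ≤ (K + 1) * t := fun t ht0 ht =>
      hι.sub_le_of_mem_thickening hψ hloc ht0 ht (hx ▸ hyb) (hx ▸ hyf.2)
        (hx ▸ closure_subset_thickening ht0 Ω hyf.1)
    have h1 := (key (r / 4) (by positivity) (by linarith)).1
    have hlim : Tendsto (fun t : ℝ => (K + 1) * t) (𝓝[>] 0) (𝓝 ((K + 1) * 0)) :=
      ((continuous_const.mul continuous_id).tendsto 0).mono_left nhdsWithin_le_nhds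
    have h2 := ge_of_tendsto hlim (by
      filter_upwards [Ioo_mem_nhdsGT (half_pos hr)] with t ht using (key t ht.1 ht.2).2)
    have h3 : h = ψ x := by linarith
    refine ⟨x, ?_, by rw [hx, h3]⟩
    rw [mem_ball, dist_eq_norm] at hyb
    rw [mem_closedBall_zero_iff]
    have := hι.norm_le_norm_add_smul x h
    rw [← hx] at this
    have := norm_sub_norm_le y p
    linarith
  have hG : LipschitzWith (1 + K) G := by
    have h1 : LipschitzWith K fun x => ψ x • v := LipschitzWith.of_dist_le_mul fun x y => by
      rw [dist_eq_norm, ← sub_smul, norm_smul, hι.norm_eq_one, mul_one, ← dist_eq_norm]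
      exact hψ.dist_le_mul x y
    exact ι.lipschitz.add h1
  refine (measure_mono hsub).trans_lt ?_
  refine (hG.lipschitzOnWith.euclideanHausdorffMeasure_image_le m).trans_lt ?_
  rw [EuclideanSpace.euclideanHausdorffMeasure_eq_volume]
  exact ENNReal.mul_lt_top (ENNReal.pow_lt_top ENNReal.coe_lt_top) measure_closedBall_lt_top

theorem eventually_volume_div_le (hι : IsFrame ι v) (hψ : LipschitzWith K ψ)
    (hSo : IsOpen S) (hSc : Convex ℝ S) (hΩo : IsOpen Ω) (hΩS : Ω ⊆ S)
    (hloc : ∀ x h, ι x + h • v ∈ ball p r → (ι x + h • v ∈ Ω ↔ ψ x < h)) (hr : 0 < r)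
    (hQm : MeasurableSet Q) (hQ : Q ⊆ ball p (r / 2)) {t : ℕ → ℝ} (ht0 : ∀ k, 0 < t k)
    (hlim : Tendsto t atTop (𝓝 0)) (hfin : μHE[m] (frontier Ω) ≠ ∞) {ε : ℝ≥0∞} (hε : ε ≠ 0) :
    ∀ᶠ k in atTop, volume ((S \ Ω) ∩ thickening (t k) Ω ∩ Q) / ENNReal.ofReal (t k) ≤
      μHE[m] (S ∩ frontier Ω ∩ closure Q) + ε := by
  obtain ⟨N, hN⟩ := eventually_atTop.1 (hlim.eventually_lt_const (half_pos hr))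
  have h1 := hι.limsup_volume_le hψ hSo hSc hΩo hΩS hloc hr hQm hQ (t := fun k => t (k + N))
    (fun k => ht0 _) (fun k => hN _ (Nat.le_add_left _ _)) ((tendsto_add_atTop_iff_nat N).2 hlim)
  have hfin' : μHE[m] (S ∩ frontier Ω ∩ closure Q) ≠ ∞ :=
    measure_ne_top_of_subset (inter_subset_left.trans inter_subset_right) hfin
  have h2 := eventually_lt_of_limsup_lt (h1.trans_lt (ENNReal.lt_add_right hfin' hε))
    (by isBoundedDefault)
  obtain ⟨M, hM⟩ := eventually_atTop.1 h2
  filter_upwards [eventually_ge_atTop (M + N)] with k hk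
  have := hM (k - N) (by omega)
  rw [Nat.sub_add_cancel (by omega)] at this
  exact this.le

end IsFrame

theorem thickening_diff_subset_thickening_frontier {E : Type*} [NormedAddCommGroup E]
    [NormedSpace ℝ E] {Ω : Set E} (hΩ : IsOpen Ω) (t : ℝ) :
    thickening t Ω \ Ω ⊆ thickening t (frontier Ω) := by
  rintro y ⟨hy, hyΩ⟩
  obtain ⟨ω, hω, hyω⟩ := mem_thickening_iff.1 hy
  have : ∃ z ∈ segment ℝ y ω, z ∈ frontier Ω := by
    by_contra! hcon
    have hy' : y ∉ closure Ω := fun h =>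
      hcon y (left_mem_segment ℝ y ω) (by rw [hΩ.frontier_eq]; exact ⟨h, hyΩ⟩)
    have hcov : segment ℝ y ω ⊆ Ω ∪ (closure Ω)ᶜ := fun z hz => by
      by_cases hzΩ : z ∈ Ω
      · exact Or.inl hzΩ
      · refine Or.inr fun hzc => hcon z hz ?_
        rw [hΩ.frontier_eq]
        exact ⟨hzc, hzΩ⟩
    obtain ⟨z, -, hz1, hz2⟩ := (convex_segment y ω).isPreconnected Ω (closure Ω)ᶜ hΩ
      isClosed_closure.isOpen_compl hcov ⟨ω, right_mem_segment ℝ y ω, hω⟩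
      ⟨y, left_mem_segment ℝ y ω, hy'⟩
    exact hz2 (subset_closure hz1)
  obtain ⟨z, hz, hzf⟩ := this
  refine mem_thickening_iff.2 ⟨z, hzf, lt_of_le_of_lt ?_ hyω⟩
  have := segment_subset_closedBall_left y ω hz
  rwa [mem_closedBall, dist_comm] at this

namespace IsLipschitzDomain

variable {m : ℕ} {Ω S : Set (EuclideanSpace ℝ (Fin (m + 1)))}

theorem exists_isFrame (hΩ : IsLipschitzDomain Ω) {x : EuclideanSpace ℝ (Fin (m + 1))}
    (hx : x ∈ frontier Ω) :
    ∃ r : ℝ, 0 < r ∧ ∃ (ι : EuclideanSpace ℝ (Fin m) →ₗᵢ[ℝ] EuclideanSpace ℝ (Fin (m + 1)))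
      (v : EuclideanSpace ℝ (Fin (m + 1))), IsFrame ι v ∧
      ∃ (K : ℝ≥0) (ψ : EuclideanSpace ℝ (Fin m) → ℝ), LipschitzWith K ψ ∧
        ∀ z h, ι z + h • v ∈ ball x r → (ι z + h • v ∈ Ω ↔ ψ z < h) := by
  obtain ⟨r, hr, v, hv, K, φ, hφ, hloc⟩ := hΩ.2.2.2 x hx
  obtain ⟨ι, hι⟩ := _root_.exists_isFrame hv
  refine ⟨r, hr, ι, v, hι, K, φ ∘ ι, ?_, fun z h hz => ?_⟩
  · simpa using hφ.comp ι.lipschitz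
  · have := hloc _ hz
    rwa [hι.inner_add_smul, add_sub_cancel_right] at this

theorem isCompact_frontier (hΩ : IsLipschitzDomain Ω) : IsCompact (frontier Ω) :=
  hΩ.2.2.1.isCompact_closure.of_isClosed_subset isClosed_frontier frontier_subset_closure

theorem euclideanHausdorffMeasure_frontier_lt_top (hΩ : IsLipschitzDomain Ω) :
    μHE[m] (frontier Ω) < ∞ := by
  have := hΩ.isCompact_frontier.induction_on (p := fun s => μHE[m] (frontier Ω ∩ s) < ∞)
    (by simp) (fun s t hst ht => (measure_mono (inter_subset_inter_right _ hst)).trans_lt ht)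
    (fun s t hs ht => by
      rw [inter_union_distrib_left]
      exact (measure_union_le _ _).trans_lt (ENNReal.add_lt_top.2 ⟨hs, ht⟩))
    (fun x hx => by
      obtain ⟨r, hr, ι, v, hι, K, ψ, hψ, hloc⟩ := hΩ.exists_isFrame hx
      exact ⟨ball x (r / 2), mem_nhdsWithin_of_mem_nhds (ball_mem_nhds x (half_pos hr)),
        hι.euclideanHausdorffMeasure_frontier_inter_ball_lt_top hψ hΩ.1 hloc⟩)
  rwa [inter_self] at this

theorem eventually_volume_div_le (hΩ : IsLipschitzDomain Ω) (hSo : IsOpen S) (hSc : Convex ℝ S)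
    (hΩS : Ω ⊆ S) {t : ℕ → ℝ} (ht0 : ∀ k, 0 < t k) (hlim : Tendsto t atTop (𝓝 0)) {ε : ℝ≥0∞}
    (hε : ε ≠ 0) :
    ∀ᶠ k in atTop, volume ((S \ Ω) ∩ thickening (t k) Ω) / ENNReal.ofReal (t k) ≤
      μHE[m] (S ∩ frontier Ω) + ε := by
  have hfin := hΩ.euclideanHausdorffMeasure_frontier_lt_top
  set μ := (μHE[m]).restrict (S ∩ frontier Ω) with hμ
  have hμfin : IsFiniteMeasure μ := ⟨by
    rw [hμ, Measure.restrict_apply_univ]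
    exact (measure_mono inter_subset_right).trans_lt hfin⟩
  set D := fun k => (S \ Ω) ∩ thickening (t k) Ω with hD
  have hμcl : ∀ Q, μ (closure Q) = μHE[m] (S ∩ frontier Ω ∩ closure Q) := fun Q => by
    rw [hμ, Measure.restrict_apply isClosed_closure.measurableSet, inter_comm]
  have hcover : ∃ U, frontier Ω ⊆ U ∧ IsOpen U ∧ μ (frontier U) = 0 ∧
      ∀ Q, MeasurableSet Q → Q ⊆ U → ∀ ε : ℝ≥0∞, ε ≠ 0 →
        ∀ᶠ k in atTop, volume (D k ∩ Q) / ENNReal.ofReal (t k) ≤ μ (closure Q) + ε := by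
    refine hΩ.isCompact_frontier.induction_on
      ⟨∅, subset_rfl, isOpen_empty, by simp, fun Q _ hQ ε _ => by simp [subset_empty_iff.1 hQ]⟩
      (fun s s' hss ⟨U, hs, hU⟩ => ⟨U, hss.trans hs, hU⟩) ?_ (fun x hx => ?_)
    · rintro s s' ⟨U, hs, hUo, hUn, hU⟩ ⟨V, hs', hVo, hVn, hV⟩
      refine ⟨U ∪ V, union_subset_union hs hs', hUo.union hVo, ?_, fun Q hQm hQ ε hε => ?_⟩
      · refine measure_mono_null (frontier_union_subset U V) (measure_union_null ?_ ?_)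
        · exact measure_mono_null inter_subset_left hUn
        · exact measure_mono_null inter_subset_right hVn
      · filter_upwards [hU (Q ∩ U) (hQm.inter hUo.measurableSet) inter_subset_right (ε / 2)
            (ENNReal.half_pos hε).ne', hV (Q \ U) (hQm.diff hUo.measurableSet)
            (sdiff_subset_iff.2 hQ) (ε / 2) (ENNReal.half_pos hε).ne'] with k hk1 hk2
        have hadd : μ (closure (Q ∩ U)) + μ (closure (Q \ U)) = μ (closure Q) := by
          rw [← measure_union₀_aux isClosed_closure.measurableSet.nullMeasurableSet
            isClosed_closure.measurableSet.nullMeasurableSet, ← closure_union, inter_union_sdiff]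
          refine measure_mono_null (fun y hy => ?_) hUn
          rw [hUo.frontier_eq]
          exact ⟨closure_mono inter_subset_right hy.1,
            closure_minimal (fun z hz => hz.2) hUo.isClosed_compl hy.2⟩
        calc volume (D k ∩ Q) / ENNReal.ofReal (t k)
            ≤ (volume (D k ∩ (Q ∩ U)) + volume (D k ∩ (Q \ U))) / ENNReal.ofReal (t k) := by
              gcongr
              conv_lhs => rw [← inter_union_sdiff Q U, inter_union_distrib_left]
              exact measure_union_le _ _
          _ ≤ (μ (closure (Q ∩ U)) + ε / 2) + (μ (closure (Q \ U)) + ε / 2) := by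
              rw [ENNReal.add_div]
              exact add_le_add hk1 hk2
          _ = μ (closure Q) + ε := by
              rw [add_add_add_comm, hadd, ENNReal.add_halves]
    · obtain ⟨r, hr, ι, v, hι, K, ψ, hψ, hloc⟩ := hΩ.exists_isFrame hx
      obtain ⟨ρ, hρ, hρn⟩ := exists_null_frontier_thickening μ {x}
        (show r / 4 < r / 2 by linarith)
      rw [thickening_singleton] at hρn
      refine ⟨ball x ρ, mem_nhdsWithin_of_mem_nhds (ball_mem_nhds x (by linarith [hρ.1])),
        ball x ρ, subset_rfl, isOpen_ball, hρn, fun Q hQm hQ ε hε => ?_⟩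
      rw [hμcl]
      exact hι.eventually_volume_div_le hψ hSo hSc hΩ.1 hΩS hloc hr hQm
        (hQ.trans (ball_subset_ball hρ.2.le)) ht0 hlim hfin.ne hε
  obtain ⟨U, hfU, hUo, -, hU⟩ := hcover
  obtain ⟨δ, hδ, hδU⟩ := hΩ.isCompact_frontier.exists_thickening_subset_open hUo hfU
  filter_upwards [hU U hUo.measurableSet subset_rfl ε hε, hlim.eventually_lt_const hδ]
    with k hk hkδ
  have hDU : D k ⊆ U := fun y hy => hδU (thickening_mono hkδ.le _
    (thickening_diff_subset_thickening_frontier hΩ.1 _ ⟨hy.2, hy.1.2⟩))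
  rw [inter_eq_left.2 hDU] at hk
  refine hk.trans ?_
  rw [hμcl]
  exact add_le_add_left (measure_mono inter_subset_left) _

end IsLipschitzDomain

theorem pow_succ_add_mul_le_add_pow (m : ℕ) {a b : ℝ} (ha : 0 ≤ a) (hb : 0 ≤ b) :
    a ^ (m + 1) + (m + 1) * a ^ m * b ≤ (a + b) ^ (m + 1) := by
  induction m with
  | zero => simp
  | succ m ih =>
    have := mul_le_mul_of_nonneg_right ih (add_nonneg ha hb)
    rw [← pow_succ] at this
    refine le_trans ?_ this
    have h : 0 ≤ (m + 1) * a ^ m * b ^ 2 := by positivity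
    push_cast
    rw [pow_succ a (m + 1), pow_succ a m] at *
    nlinarith

section ConvexCone

variable {n : ℕ} {S Ω : Set (EuclideanSpace ℝ (Fin n))}

theorem add_smul_ball_subset_union (hSc : Convex ℝ S)
    (hScone : ∀ x ∈ S, ∀ t : ℝ, 0 < t → t • x ∈ S) (hΩS : Ω ⊆ S) {t : ℝ} (ht : 0 < t) :
    Ω + t • (S ∩ ball 0 1) ⊆ Ω ∪ (S \ Ω) ∩ thickening t Ω := by
  rintro _ ⟨x, hx, _, ⟨k, hk, rfl⟩, rfl⟩
  by_cases hΩ : x + t • k ∈ Ω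
  · exact Or.inl hΩ
  refine Or.inr ⟨⟨?_, hΩ⟩, mem_thickening_iff.2 ⟨x, hx, ?_⟩⟩
  · have h1 := hSc (hΩS hx) (hScone k hk.1 t ht) (a := 1 / 2) (b := 1 / 2) (by norm_num)
      (by norm_num) (by norm_num)
    have h2 := hScone _ h1 2 two_pos
    rw [← smul_add, smul_smul] at h2
    norm_num at h2
    exact h2
  · have := hk.2
    rw [mem_ball_zero_iff] at this
    simp only [dist_self_add_left, norm_smul, Real.norm_of_nonneg ht.le]
    nlinarith

end ConvexCone

section Succ

variable {m : ℕ} {S Ω : Set (EuclideanSpace ℝ (Fin (m + 1)))}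

theorem inter_frontier_inter_ball_subset_sphere (hSo : IsOpen S) :
    S ∩ frontier (S ∩ ball 0 1) ⊆ sphere 0 1 := by
  rintro y ⟨hyS, hyf⟩
  rw [(hSo.inter isOpen_ball).frontier_eq] at hyf
  have h1 : y ∈ closedBall 0 1 :=
    closure_minimal (inter_subset_right.trans ball_subset_closedBall) isClosed_closedBall hyf.1
  have h2 : y ∉ ball 0 1 := fun h => hyf.2 ⟨hyS, h⟩
  rw [mem_closedBall] at h1
  rw [mem_ball, not_lt] at h2
  exact le_antisymm h1 h2

theorem euclideanHausdorffMeasure_inter_frontier_inter_ball_le (hSo : IsOpen S)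
    (hScone : ∀ x ∈ S, ∀ t : ℝ, 0 < t → t • x ∈ S) :
    μHE[m] (S ∩ frontier (S ∩ ball 0 1)) ≤ (m + 1 : ℕ) * volume (S ∩ ball 0 1) := by
  have hm : MeasurableSet (S ∩ frontier (S ∩ ball 0 1)) :=
    hSo.measurableSet.inter isClosed_frontier.measurableSet
  refine (euclideanHausdorffMeasure_le_of_subset_sphere hm
    (inter_frontier_inter_ball_subset_sphere hSo)).trans (mul_le_mul_right ?_ _)
  rw [sphereConeMeasure_apply hm]
  refine measure_mono ?_
  rintro y ⟨hy1, hyS, hyf⟩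
  have h1 := inter_frontier_inter_ball_subset_sphere hSo ⟨hyS, hyf⟩
  have hy0 : 0 < ‖y‖ := by
    refine norm_pos_iff.2 fun h => ?_
    rw [h, smul_zero, mem_sphere, dist_self] at h1
    exact zero_ne_one h1
  refine ⟨?_, mem_ball_zero_iff.2 hy1⟩
  have := hScone _ hyS ‖y‖ hy0
  rwa [smul_smul, mul_inv_cancel₀ hy0.ne', one_smul] at this

theorem ofReal_le_volume_inter_thickening_div (hSc : Convex ℝ S) (hSo : IsOpen S)
    (hScone : ∀ x ∈ S, ∀ t : ℝ, 0 < t → t • x ∈ S) (hΩo : IsOpen Ω) (hΩS : Ω ⊆ S)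
    {R ρ : ℝ} (hR : 0 < R) (hρ : 0 < ρ) (hΩR : volume Ω = ENNReal.ofReal (R ^ (m + 1)))
    (hSρ : volume (S ∩ ball 0 1) = ENNReal.ofReal (ρ ^ (m + 1))) {t : ℝ} (ht : 0 < t) :
    ENNReal.ofReal ((m + 1) * R ^ m * ρ) ≤
      volume ((S \ Ω) ∩ thickening t Ω) / ENNReal.ofReal t := by
  have htK : volume (t • (S ∩ ball 0 1)) = ENNReal.ofReal ((t * ρ) ^ (m + 1)) := by
    rw [Measure.addHaar_smul, hSρ, finrank_euclideanSpace_fin, abs_of_pos (by positivity),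
      ← ENNReal.ofReal_mul (by positivity), mul_pow]
  have hBM := brunnMinkowski hΩo ((hSo.inter isOpen_ball).measurableSet.const_smul₀ t) hR
    (mul_pos ht hρ) hΩR htK
  have h1 := hBM.trans ((measure_mono (add_smul_ball_subset_union hSc hScone hΩS ht)).trans
    (measure_union_le _ _))
  have h2 := (ENNReal.ofReal_le_ofReal
    (pow_succ_add_mul_le_add_pow m hR.le (mul_pos ht hρ).le)).trans h1
  rw [ENNReal.ofReal_add (by positivity) (by positivity), hΩR,
    ENNReal.add_le_add_iff_left ENNReal.ofReal_ne_top] at h2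
  rw [ENNReal.le_div_iff_mul_le (Or.inl (by simpa using ht)) (Or.inl ENNReal.ofReal_ne_top),
    ← ENNReal.ofReal_mul (by positivity)]
  convert h2 using 2
  ring

theorem IsLipschitzDomain.ofReal_le_euclideanHausdorffMeasure (hΩ : IsLipschitzDomain Ω)
    (hSc : Convex ℝ S) (hSo : IsOpen S) (hScone : ∀ x ∈ S, ∀ t : ℝ, 0 < t → t • x ∈ S)
    (hΩS : Ω ⊆ S) {R ρ : ℝ} (hR : 0 < R) (hρ : 0 < ρ)
    (hΩR : volume Ω = ENNReal.ofReal (R ^ (m + 1)))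
    (hSρ : volume (S ∩ ball 0 1) = ENNReal.ofReal (ρ ^ (m + 1))) :
    ENNReal.ofReal ((m + 1) * R ^ m * ρ) ≤ μHE[m] (S ∩ frontier Ω) := by
  refine ENNReal.le_of_forall_pos_le_add fun ε hε _ => ?_
  obtain ⟨k, hk⟩ := (hΩ.eventually_volume_div_le hSo hSc hΩS
    (t := fun k : ℕ => 1 / ((k : ℝ) + 1)) (fun k => by positivity)
    tendsto_one_div_add_atTop_nhds_zero_nat (ENNReal.coe_ne_zero.2 hε.ne')).exists
  exact (ofReal_le_volume_inter_thickening_div hSc hSo hScone hΩ.1 hΩS hR hρ hΩR hSρ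
    (by positivity)).trans hk

theorem exists_volume_eq_ofReal_pow {U : Set (EuclideanSpace ℝ (Fin (m + 1)))} (hU : IsOpen U)
    (hne : U.Nonempty) (hb : Bornology.IsBounded U) :
    ∃ R : ℝ, 0 < R ∧ volume U = ENNReal.ofReal (R ^ (m + 1)) := by
  have hpos : 0 < (volume U).toReal :=
    ENNReal.toReal_pos (hU.measure_pos volume hne).ne' hb.measure_lt_top.ne
  refine ⟨(volume U).toReal ^ ((m + 1 : ℕ) : ℝ)⁻¹, Real.rpow_pos_of_pos hpos _, ?_⟩
  rw [Real.rpow_inv_natCast_pow hpos.le (by omega), ENNReal.ofReal_toReal hb.measure_lt_top.ne]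

end Succ

/-- **Isoperimetric inequality in convex cones (Lions–Pacella).**
Let `S` be an open convex cone in `ℝⁿ`. For every bounded Lipschitz domain `Ω ⊆ S`,
the relative perimeter `P_S(Ω) = σ(S ∩ ∂Ω)` (with `σ` the `(n-1)`-dimensional Hausdorff
measure) and the Lebesgue volume satisfy
`P_S(Ω)/|Ω|^{(n-1)/n} ≥ P_S(S ∩ B₁)/|S ∩ B₁|^{(n-1)/n}`. -/
theorem isoperimetric_inequality_in_convex_cones_lions_pacella
    (n : ℕ) (hn : 1 ≤ n)
    (S : Set (EuclideanSpace ℝ (Fin n)))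
    (hSopen : IsOpen S) (hSconv : Convex ℝ S)
    (hScone : ∀ x ∈ S, ∀ t : ℝ, 0 < t → t • x ∈ S)
    (Ω : Set (EuclideanSpace ℝ (Fin n))) (hΩ : IsLipschitzDomain Ω) (hΩS : Ω ⊆ S) :
    (μH[(n : ℝ) - 1] (S ∩ frontier (S ∩ ball (0 : EuclideanSpace ℝ (Fin n)) 1))).toReal /
      ((volume (S ∩ ball (0 : EuclideanSpace ℝ (Fin n)) 1)).toReal) ^
        (((n : ℝ) - 1) / (n : ℝ)) ≤
    (μH[(n : ℝ) - 1] (S ∩ frontier Ω)).toReal /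
      ((volume Ω).toReal) ^ (((n : ℝ) - 1) / (n : ℝ)) := by
  obtain ⟨m, rfl⟩ : ∃ m, n = m + 1 := ⟨n - 1, by omega⟩
  obtain ⟨x, hx⟩ := hΩ.2.1.nonempty
  have hSne : (S ∩ ball (0 : EuclideanSpace ℝ (Fin (m + 1))) 1).Nonempty := by
    refine ⟨(‖x‖ + 1)⁻¹ • x, hScone x (hΩS hx) _ (by positivity), ?_⟩
    rw [mem_ball_zero_iff, norm_smul, Real.norm_of_nonneg (by positivity),
      inv_mul_lt_one₀ (by positivity)]
    linarith
  obtain ⟨R, hR, hΩR⟩ := exists_volume_eq_ofReal_pow hΩ.1 ⟨x, hx⟩ hΩ.2.2.1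
  obtain ⟨ρ, hρ, hSρ⟩ := exists_volume_eq_ofReal_pow (hSopen.inter isOpen_ball) hSne
    (isBounded_ball.subset inter_subset_right)
  have h1 := euclideanHausdorffMeasure_inter_frontier_inter_ball_le hSopen hScone
  have h2 := hΩ.ofReal_le_euclideanHausdorffMeasure hSconv hSopen hScone hΩS hR hρ hΩR hSρ
  have hfin : μHE[m] (S ∩ frontier Ω) ≠ ∞ :=
    measure_ne_top_of_subset inter_subset_right hΩ.euclideanHausdorffMeasure_frontier_lt_top.ne
  rw [hSρ] at h1
  have h1' := ENNReal.toReal_mono (ENNReal.mul_ne_top (by simp) ENNReal.ofReal_ne_top) h1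
  have h2' := ENNReal.toReal_mono hfin h2
  rw [ENNReal.toReal_mul, ENNReal.toReal_natCast, ENNReal.toReal_ofReal (by positivity)] at h1'
  rw [ENNReal.toReal_ofReal (by positivity)] at h2'
  set c := Measure.addHaarScalarFactor (volume : Measure (EuclideanSpace ℝ (Fin m)))
    (μH[m] : Measure (EuclideanSpace ℝ (Fin m)))
  have hc : (0 : ℝ) < c := NNReal.coe_pos.2
    (pos_iff_ne_zero.2 (Measure.addHaarScalarFactor_volume_hausdorffMeasure_ne_zero m))
  have hHE : ∀ A : Set (EuclideanSpace ℝ (Fin (m + 1))),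
      (μHE[m] A).toReal = c * (μH[(m : ℝ)] A).toReal := fun A => by
    rw [Measure.euclideanHausdorffMeasure_def, Measure.smul_apply, ENNReal.smul_def, smul_eq_mul,
      ENNReal.toReal_mul, ENNReal.coe_toReal]
  rw [hHE] at h1' h2'
  have hexp : ∀ a : ℝ, 0 < a → (a ^ (m + 1)) ^ ((m : ℝ) / ((m : ℝ) + 1)) = a ^ m := fun a ha => by
    rw [← Real.rpow_natCast, ← Real.rpow_natCast, ← Real.rpow_mul ha.le]
    congr 1
    push_cast
    field_simp
  have hm : ((m + 1 : ℕ) : ℝ) - 1 = m := by push_cast; ring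
  rw [hm, hSρ, hΩR, ENNReal.toReal_ofReal (by positivity), ENNReal.toReal_ofReal (by positivity),
    Nat.cast_succ, hexp ρ hρ, hexp R hR, div_le_div_iff₀ (by positivity) (by positivity)]
  push_cast at h1'
  have h3 := mul_le_mul_of_nonneg_right h1' (pow_nonneg hR.le m)
  have h4 := mul_le_mul_of_nonneg_right h2' (pow_nonneg hρ.le m)
  refine le_of_mul_le_mul_left ?_ hc
  rw [pow_succ] at h3
  linarith

end
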